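/- arXiv:1912.00621 — 2 statements merged into one kernel-verified Lean document; each statement's English description precedes it below -/
import Mathlib

section
/- Let C be a locally finite, Krull-Schmidt, K-linear extriangulated category (K a field) with dim_K Hom_C(X,Y) < ∞ and dim_K E(X,Y) < ∞ for all X,Y ∈ C. If X ∈ Ind(C) is a non-projective object, then there is an Auslander-Reiten E-triangle ending at X. Dually, if X ∈ Ind(C) is a non-injective object, then there is an Auslander-Reiten E-triangle starting at X. Hence C has Auslander-Reiten E-triangles. -/
open CategoryTheory CategoryTheory.Limits Opposite ZeroObject

attribute [local instance] CategoryTheory.Limits.hasBinaryBiproducts_of_finite_biproducts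

universe w v u

noncomputable section

/-- An object of a preadditive category with finite biproducts is *indecomposable* if it is
nonzero and admits no nontrivial direct sum decomposition. -/
def Indec {C : Type u} [Category.{v} C] [Preadditive C] [HasFiniteBiproducts C] (X : C) : Prop :=
  ¬ IsZero X ∧ ∀ (Y Z : C), Nonempty (X ≅ Y ⊞ Z) → IsZero Y ∨ IsZero Z

/-- A preadditive category is *Krull-Schmidt* if every object is (isomorphic to) a finite
biproduct of objects having local endomorphism rings. -/
def IsKrullSchmidt (C : Type u) [Category.{v} C] [Preadditive C] [HasFiniteBiproducts C] : Prop :=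
  ∀ X : C, ∃ (n : ℕ) (f : Fin n → C),
    (∀ i, IsLocalRing (CategoryTheory.End (f i))) ∧ Nonempty (X ≅ ⨁ f)

/-- `C` is *locally finite*: for every indecomposable `A` there are, up to isomorphism, only
finitely many indecomposables `B` with `Hom(A, B) ≠ 0`, and only finitely many indecomposables
`B` with `Hom(B, A) ≠ 0`. -/
def LocFinite (C : Type u) [Category.{v} C] [Preadditive C] [HasFiniteBiproducts C] : Prop :=
  ∀ A : C, Indec A →
    (∃ (n : ℕ) (ind : Fin n → C), ∀ B : C, Indec B → (∃ φ : A ⟶ B, φ ≠ 0) →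
        ∃ i, Nonempty (B ≅ ind i)) ∧
    (∃ (n : ℕ) (ind : Fin n → C), ∀ B : C, Indec B → (∃ φ : B ⟶ A, φ ≠ 0) →
        ∃ i, Nonempty (B ≅ ind i))

section ExtCatDef

variable (K : Type w) [Field K]
variable (C : Type u) [Category.{v} C] [Preadditive C] [Linear K C] [HasFiniteBiproducts C]

/-- An extriangulated structure (in the sense of Nakaoka–Palu) on the `K`-linear category `C`,
with `K`-linear extension groups: a biadditive functor `E : Cᵒᵖ × C → Ab` (here landing in
`K`-modules, recording the `K`-linear structure on the extension groups) together with an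
additive realization `real` of extensions by conflations, satisfying (ET1)–(ET4) and their
duals. -/
structure ExtCat where
  /-- the biadditive functor `E : Cᵒᵖ × C → Ab`. -/
  E : Cᵒᵖ ⥤ C ⥤ ModuleCat.{v} K
  additive₁ : E.Additive
  additive₂ : ∀ c : Cᵒᵖ, (E.obj c).Additive
  /-- `real x y δ` says that the sequence `x, y` realizes the extension `δ`, i.e.
  `(x, y, δ)` is an `E`-triangle. -/
  real : ∀ {a b c : C}, (a ⟶ b) → (b ⟶ c) → ((E.obj (op c)).obj a) → Prop
  /-- every extension is realized by some conflation. -/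
  real_exists : ∀ {a c : C} (δ : (E.obj (op c)).obj a),
    ∃ (b : C) (x : a ⟶ b) (y : b ⟶ c), real x y δ
  /-- the realization is well defined on equivalence classes of sequences. -/
  real_congr : ∀ {a b b' c : C} {x : a ⟶ b} {y : b ⟶ c} {x' : a ⟶ b'} {y' : b' ⟶ c}
    {δ : (E.obj (op c)).obj a} (e : b ≅ b'),
      x ≫ e.hom = x' → e.hom ≫ y' = y → real x y δ → real x' y' δ
  /-- any two realizations of the same extension are equivalent sequences. -/
  real_unique : ∀ {a b b' c : C} {x : a ⟶ b} {y : b ⟶ c} {x' : a ⟶ b'} {y' : b' ⟶ c}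
    {δ : (E.obj (op c)).obj a}, real x y δ → real x' y' δ →
      ∃ e : b ≅ b', x ≫ e.hom = x' ∧ e.hom ≫ y' = y
  /-- (ET2) realization of morphisms of extensions: if `f_* δ = g^* δ'` then `(f, g)` extends to
  a morphism of the realizing `E`-triangles. -/
  real_lift : ∀ {a b c a' b' c' : C} {x : a ⟶ b} {y : b ⟶ c} {x' : a' ⟶ b'} {y' : b' ⟶ c'}
    {δ : (E.obj (op c)).obj a} {δ' : (E.obj (op c')).obj a'} (f : a ⟶ a') (g : c ⟶ c'),
      real x y δ → real x' y' δ' →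
      ((E.obj (op c)).map f) δ = ((E.map g.op).app a') δ' →
      ∃ m : b ⟶ b', x ≫ m = f ≫ x' ∧ m ≫ y' = y ≫ g
  /-- the realization is additive, part (i): split extensions are realized by split sequences. -/
  real_zero : ∀ a c : C,
    real (biprod.inl : a ⟶ a ⊞ c) (biprod.snd : a ⊞ c ⟶ c) (0 : (E.obj (op c)).obj a)
  /-- the realization is additive, part (ii): it commutes with direct sums. -/
  real_sum : ∀ {a b c a' b' c' : C} {x : a ⟶ b} {y : b ⟶ c} {x' : a' ⟶ b'} {y' : b' ⟶ c'}
    {δ : (E.obj (op c)).obj a} {δ' : (E.obj (op c')).obj a'},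
      real x y δ → real x' y' δ' →
      real (biprod.map x x') (biprod.map y y')
        (((E.map (biprod.fst : c ⊞ c' ⟶ c).op).app (a ⊞ a'))
            (((E.obj (op c)).map (biprod.inl : a ⟶ a ⊞ a')) δ) +
         ((E.map (biprod.snd : c ⊞ c' ⟶ c').op).app (a ⊞ a'))
            (((E.obj (op c')).map (biprod.inr : a' ⟶ a ⊞ a')) δ'))
  /-- (ET3). -/
  et3 : ∀ {a b c a' b' c' : C} {x : a ⟶ b} {y : b ⟶ c} {x' : a' ⟶ b'} {y' : b' ⟶ c'}
    {δ : (E.obj (op c)).obj a} {δ' : (E.obj (op c')).obj a'} (f : a ⟶ a') (m : b ⟶ b'),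
      real x y δ → real x' y' δ' → x ≫ m = f ≫ x' →
      ∃ g : c ⟶ c', y ≫ g = m ≫ y' ∧ ((E.obj (op c)).map f) δ = ((E.map g.op).app a') δ'
  /-- (ET3)ᵒᵖ. -/
  et3op : ∀ {a b c a' b' c' : C} {x : a ⟶ b} {y : b ⟶ c} {x' : a' ⟶ b'} {y' : b' ⟶ c'}
    {δ : (E.obj (op c)).obj a} {δ' : (E.obj (op c')).obj a'} (g : c ⟶ c') (m : b ⟶ b'),
      real x y δ → real x' y' δ' → m ≫ y' = y ≫ g →
      ∃ f : a ⟶ a', x ≫ m = f ≫ x' ∧ ((E.obj (op c)).map f) δ = ((E.map g.op).app a') δ'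
  /-- (ET4). -/
  et4 : ∀ {A B D F G : C} {f : A ⟶ B} {f' : B ⟶ D} {g : B ⟶ G} {g' : G ⟶ F}
    {δ : (E.obj (op D)).obj A} {δ' : (E.obj (op F)).obj B},
      real f f' δ → real g g' δ' →
      ∃ (Eo : C) (d : D ⟶ Eo) (e : Eo ⟶ F) (h' : G ⟶ Eo) (δ'' : (E.obj (op Eo)).obj A),
        real (f ≫ g) h' δ'' ∧ f' ≫ d = g ≫ h' ∧ h' ≫ e = g' ∧
        real d e (((E.obj (op F)).map f') δ') ∧
        ((E.map d.op).app A) δ'' = δ ∧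
        ((E.obj (op Eo)).map f) δ'' = ((E.map e.op).app B) δ'
  /-- (ET4)ᵒᵖ. -/
  et4op : ∀ {A B D F Cc : C} {f' : D ⟶ A} {f : A ⟶ B} {g' : F ⟶ B} {g : B ⟶ Cc}
    {δ : (E.obj (op B)).obj D} {δ' : (E.obj (op Cc)).obj F},
      real f' f δ → real g' g δ' →
      ∃ (Eo : C) (d : D ⟶ Eo) (e : Eo ⟶ F) (h' : Eo ⟶ A) (δ'' : (E.obj (op Cc)).obj Eo),
        real h' (f ≫ g) δ'' ∧ d ≫ h' = f' ∧ h' ≫ f = e ≫ g' ∧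
        real d e (((E.map g'.op).app D) δ) ∧
        ((E.obj (op Cc)).map e) δ'' = δ' ∧
        ((E.obj (op B)).map d) δ = ((E.map g.op).app Eo) δ''

end ExtCatDef

namespace ExtCat

variable {K : Type w} [Field K]
variable {C : Type u} [Category.{v} C] [Preadditive C] [Linear K C] [HasFiniteBiproducts C]
variable (ξ : ExtCat K C)

/-- The extension group `E(c, a)`. -/
abbrev Ext (c a : C) : Type v := (ξ.E.obj (op c)).obj a

/-- Pushforward `f_* : E(c, a) → E(c, a')` along `f : a ⟶ a'`. -/
def push (c : C) {a a' : C} (f : a ⟶ a') (δ : ξ.Ext c a) : ξ.Ext c a' :=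
  ((ξ.E.obj (op c)).map f) δ

/-- Pullback `g^* : E(c, a) → E(c', a)` along `g : c' ⟶ c`. -/
def pull (a : C) {c c' : C} (g : c' ⟶ c) (δ : ξ.Ext c a) : ξ.Ext c' a :=
  ((ξ.E.map g.op).app a) δ

/-- An object `P` is projective if `E(P, A) = 0` for all `A`. -/
def ProjObj (P : C) : Prop := ∀ (A : C) (δ : ξ.Ext P A), δ = 0

/-- An object `I` is injective if `E(A, I) = 0` for all `A`. -/
def InjObj (I : C) : Prop := ∀ (A : C) (δ : ξ.Ext A I), δ = 0

end ExtCat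

/-- A non-split `E`-extension `δ ∈ E(c, a)` is *almost split* if
(AS1) `f_* δ = 0` for every non-section `f : a ⟶ a'`, and
(AS2) `g^* δ = 0` for every non-retraction `g : c' ⟶ c`.
An `E`-triangle realizing an almost split extension is an Auslander–Reiten `E`-triangle. -/
def ExtCat.AlmostSplit {K : Type w} [Field K] {C : Type u} [Category.{v} C] [Preadditive C]
    [HasFiniteBiproducts C] (ξ : ExtCat K C) {a c : C} (δ : ξ.Ext c a) : Prop :=
  δ ≠ 0 ∧
  (∀ {a' : C} (f : a ⟶ a'), (¬ ∃ r : a' ⟶ a, f ≫ r = 𝟙 a) → ξ.push c f δ = 0) ∧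
  (∀ {c' : C} (g : c' ⟶ c), (¬ ∃ s : c ⟶ c', s ≫ g = 𝟙 c) → ξ.pull a g δ = 0)

namespace ExtCat

variable {K : Type w} [Field K]
variable {C : Type u} [Category.{v} C] [Preadditive C] [HasFiniteBiproducts C]
variable (ξ : ExtCat K C)

theorem push_zero_ext (c : C) {a a' : C} (f : a ⟶ a') : ξ.push c f 0 = 0 := by
  simp [push]

theorem pull_zero_ext (a : C) {c c' : C} (g : c' ⟶ c) : ξ.pull a g 0 = 0 := by
  simp [pull]

theorem push_id (c : C) {a : C} (δ : ξ.Ext c a) : ξ.push c (𝟙 a) δ = δ := by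
  simp [push]

theorem pull_id (a : C) {c : C} (δ : ξ.Ext c a) : ξ.pull a (𝟙 c) δ = δ := by
  simp [pull]

theorem push_comp (c : C) {a a' a'' : C} (f : a ⟶ a') (g : a' ⟶ a'') (δ : ξ.Ext c a) :
    ξ.push c (f ≫ g) δ = ξ.push c g (ξ.push c f δ) := by
  simp [push]

theorem pull_comp (a : C) {c c' c'' : C} (f : c'' ⟶ c') (g : c' ⟶ c) (δ : ξ.Ext c a) :
    ξ.pull a (f ≫ g) δ = ξ.pull a f (ξ.pull a g δ) := by
  simp [pull]

theorem push_add (c : C) {a a' : C} (f g : a ⟶ a') (δ : ξ.Ext c a) :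
    ξ.push c (f + g) δ = ξ.push c f δ + ξ.push c g δ := by
  haveI := ξ.additive₂ (op c)
  simp [push, Functor.map_add]

theorem pull_add (a : C) {c c' : C} (f g : c' ⟶ c) (δ : ξ.Ext c a) :
    ξ.pull a (f + g) δ = ξ.pull a f δ + ξ.pull a g δ := by
  haveI := ξ.additive₁
  simp [pull, Functor.map_add]

theorem push_zero_hom (c : C) {a a' : C} (δ : ξ.Ext c a) :
    ξ.push c (0 : a ⟶ a') δ = 0 := by
  have := ξ.push_add c (0 : a ⟶ a') 0 δ
  simpa using this

theorem pull_zero_hom (a : C) {c c' : C} (δ : ξ.Ext c a) :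
    ξ.pull a (0 : c' ⟶ c) δ = 0 := by
  have := ξ.pull_add a (0 : c' ⟶ c) 0 δ
  simpa using this

theorem push_pull {a a' c c' : C} (f : a ⟶ a') (g : c' ⟶ c) (δ : ξ.Ext c a) :
    ξ.push c' f (ξ.pull a g δ) = ξ.pull a' g (ξ.push c f δ) := by
  have := (ξ.E.map g.op).naturality f
  have := congrArg (fun t => t.hom δ) this
  simpa [push, pull] using this.symm

theorem push_sum (c : C) {a a' : C} {ι : Type*} (s : Finset ι) (f : ι → (a ⟶ a'))
    (δ : ξ.Ext c a) : ξ.push c (∑ i ∈ s, f i) δ = ∑ i ∈ s, ξ.push c (f i) δ := by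
  classical
  induction s using Finset.induction_on with
  | empty => simpa using ξ.push_zero_hom c δ
  | insert i s hi ih => rw [Finset.sum_insert hi, Finset.sum_insert hi, push_add, ih]

theorem pull_sum (a : C) {c c' : C} {ι : Type*} (s : Finset ι) (f : ι → (c' ⟶ c))
    (δ : ξ.Ext c a) : ξ.pull a (∑ i ∈ s, f i) δ = ∑ i ∈ s, ξ.pull a (f i) δ := by
  classical
  induction s using Finset.induction_on with
  | empty => simpa using ξ.pull_zero_hom a δ
  | insert i s hi ih => rw [Finset.sum_insert hi, Finset.sum_insert hi, pull_add, ih]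

variable {ξ}

theorem real_pull {a b c : C} {x : a ⟶ b} {y : b ⟶ c} {δ : ξ.Ext c a} (h : ξ.real x y δ) :
    ξ.pull a y δ = 0 := by
  obtain ⟨f, -, h2⟩ := ξ.et3op (g := y) (m := (biprod.snd : (0 : C) ⊞ b ⟶ b))
    (ξ.real_zero 0 b) h rfl
  exact h2.symm.trans (ξ.push_zero_ext b f)

theorem real_push {a b c : C} {x : a ⟶ b} {y : b ⟶ c} {δ : ξ.Ext c a} (h : ξ.real x y δ) :
    ξ.push c x δ = 0 := by
  obtain ⟨g, -, h2⟩ := ξ.et3 (f := x) (m := (biprod.inl : b ⟶ b ⊞ (0 : C)))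
    h (ξ.real_zero b 0) rfl
  exact h2.trans (ξ.pull_zero_ext b g)

theorem real_factor_right {a b c w : C} {x : a ⟶ b} {y : b ⟶ c} {δ : ξ.Ext c a}
    (h : ξ.real x y δ) (g : w ⟶ c) (hg : ξ.pull a g δ = 0) : ∃ m : w ⟶ b, m ≫ y = g := by
  obtain ⟨m, -, h2⟩ := ξ.real_lift (0 : (0 : C) ⟶ a) g (ξ.real_zero 0 w) h
    ((ξ.push_zero_ext w _).trans hg.symm)
  exact ⟨biprod.inr ≫ m, by rw [Category.assoc, h2]; simp⟩

theorem real_factor_left {a b c w : C} {x : a ⟶ b} {y : b ⟶ c} {δ : ξ.Ext c a}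
    (h : ξ.real x y δ) (f : a ⟶ w) (hf : ξ.push c f δ = 0) : ∃ m : b ⟶ w, x ≫ m = f := by
  obtain ⟨m, h1, -⟩ := ξ.real_lift f (0 : c ⟶ (0 : C)) h (ξ.real_zero w 0)
    (hf.trans (ξ.pull_zero_ext w _).symm)
  exact ⟨m ≫ biprod.fst, by rw [← Category.assoc, h1]; simp⟩

end ExtCat

section Loc

variable {C : Type u} [Category.{v} C] [Preadditive C] [HasFiniteBiproducts C]

/-- Elementary form of "the endomorphism ring is local". -/
def LocE (X : C) : Prop := ¬ IsZero X ∧ ∀ a b : X ⟶ X, a + b = 𝟙 X → IsIso a ∨ IsIso b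

theorem LocE.of_isLocalRing {X : C} (h : IsLocalRing (CategoryTheory.End X)) : LocE X := by
  constructor
  · intro hz
    have : (1 : CategoryTheory.End X) = 0 := hz.eq_of_src _ _
    exact one_ne_zero this
  · intro a b hab
    rcases IsLocalRing.isUnit_or_isUnit_of_add_one (R := CategoryTheory.End X) (a := a) (b := b)
      hab with h | h
    · exact Or.inl ((isUnit_iff_isIso a).1 h)
    · exact Or.inr ((isUnit_iff_isIso b).1 h)

theorem LocE.of_iso {X Y : C} (e : X ≅ Y) (h : LocE Y) : LocE X := by
  constructor
  · intro hz
    exact h.1 (hz.of_iso e.symm)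
  · intro a b hab
    have key : ∀ a : X ⟶ X, IsIso (e.inv ≫ a ≫ e.hom) → IsIso a := by
      intro a ha
      have : a = e.hom ≫ (e.inv ≫ a ≫ e.hom) ≫ e.inv := by simp
      rw [this]
      infer_instance
    have : e.inv ≫ a ≫ e.hom + e.inv ≫ b ≫ e.hom = 𝟙 Y := by
      rw [← Preadditive.comp_add, ← Preadditive.add_comp, hab]; simp
    rcases h.2 _ _ this with h | h
    · exact Or.inl (key a h)
    · exact Or.inr (key b h)

theorem LocE.indec {X : C} (h : LocE X) : Indec X := by
  refine ⟨h.1, ?_⟩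
  rintro Y Z ⟨e⟩
  have hYZ : LocE (Y ⊞ Z) := h.of_iso e.symm
  have hsum : (biprod.fst ≫ biprod.inl : Y ⊞ Z ⟶ Y ⊞ Z) + biprod.snd ≫ biprod.inr = 𝟙 _ :=
    biprod.total
  rcases hYZ.2 _ _ hsum with hi | hi
  · right
    rw [IsZero.iff_id_eq_zero]
    have : (biprod.inr : Z ⟶ Y ⊞ Z) = 0 := by
      rw [← cancel_mono (biprod.fst ≫ biprod.inl : Y ⊞ Z ⟶ Y ⊞ Z)]; simp
    have h2 := biprod.inr_snd (X := Y) (Y := Z)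
    rw [this] at h2
    simpa using h2.symm
  · left
    rw [IsZero.iff_id_eq_zero]
    have : (biprod.inl : Y ⟶ Y ⊞ Z) = 0 := by
      rw [← cancel_mono (biprod.snd ≫ biprod.inr : Y ⊞ Z ⟶ Y ⊞ Z)]; simp
    have h2 := biprod.inl_fst (X := Y) (Y := Z)
    rw [this] at h2
    simpa using h2.symm

/-- Decomposition of the identity in a Krull-Schmidt category. -/
theorem IsKrullSchmidt.decomp (hKS : IsKrullSchmidt C) (X : C) :
    ∃ (n : ℕ) (f : Fin n → C) (p : ∀ i, X ⟶ f i) (q : ∀ i, f i ⟶ X),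
      (∀ i, LocE (f i)) ∧ ∑ i, p i ≫ q i = 𝟙 X := by
  obtain ⟨n, f, hf, ⟨e⟩⟩ := hKS X
  refine ⟨n, f, fun i => e.hom ≫ biproduct.π f i, fun i => biproduct.ι f i ≫ e.inv,
    fun i => LocE.of_isLocalRing (hf i), ?_⟩
  have : ∀ i, (e.hom ≫ biproduct.π f i) ≫ biproduct.ι f i ≫ e.inv
      = e.hom ≫ (biproduct.π f i ≫ biproduct.ι f i) ≫ e.inv := by intro i; simp
  simp_rw [this]
  rw [← Preadditive.comp_sum, ← Preadditive.sum_comp, biproduct.total]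
  simp

theorem biproduct_succ {n : ℕ} (f : Fin (n + 1) → C) :
    Nonempty ((⨁ f) ≅ f 0 ⊞ ⨁ (fun j : Fin n => f j.succ)) := by
  refine ⟨⟨biprod.lift (biproduct.π f 0) (biproduct.lift fun j => biproduct.π f j.succ),
    biprod.desc (biproduct.ι f 0) (biproduct.desc fun j => biproduct.ι f j.succ), ?_, ?_⟩⟩
  · rw [biprod.lift_desc, biproduct.lift_desc, ← biproduct.total, Fin.sum_univ_succ]
  · apply biprod.hom_ext <;> apply biprod.hom_ext'
    · simp
    · simp only [Category.assoc, biprod.lift_fst, biprod.inr_desc_assoc, Category.id_comp,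
        biprod.inr_fst]
      apply biproduct.hom_ext'
      intro j
      simp [biproduct.ι_π_ne f (Fin.succ_ne_zero j)]
    · simp only [Category.assoc, biprod.lift_snd, biprod.inl_desc_assoc, Category.id_comp,
        biprod.inl_snd]
      apply biproduct.hom_ext
      intro j
      simp [biproduct.ι_π_ne f (Fin.succ_ne_zero j).symm]
    · simp only [Category.assoc, biprod.lift_snd, biprod.inr_desc_assoc, Category.id_comp,
        biprod.inr_snd]
      apply biproduct.hom_ext
      intro j
      apply biproduct.hom_ext'
      intro k
      by_cases hk : k = j
      · subst hk; simp
      · have hk' : k.succ ≠ j.succ := fun h => hk (Fin.succ_injective _ h)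
        simp [biproduct.ι_π_ne f hk', biproduct.ι_π_ne (fun j : Fin n => f j.succ) hk]

theorem Indec.locE (hKS : IsKrullSchmidt C) {X : C} (hX : Indec X) : LocE X := by
  obtain ⟨n, f, hf, ⟨e⟩⟩ := hKS X
  cases n with
  | zero =>
    exfalso
    apply hX.1
    refine IsZero.of_iso ?_ e
    rw [IsZero.iff_id_eq_zero]
    apply biproduct.hom_ext
    intro j
    exact j.elim0
  | succ n =>
    obtain ⟨e2⟩ := biproduct_succ f
    have h0 := LocE.of_isLocalRing (hf 0)
    rcases hX.2 _ _ ⟨e ≪≫ e2⟩ with h | h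
    · exact absurd h h0.1
    · refine h0.of_iso ((e ≪≫ e2) ≪≫ ⟨biprod.fst, biprod.inl, ?_, by simp⟩)
      apply biprod.hom_ext
      · simp
      · exact h.eq_of_tgt _ _

/-- `g` is a retraction. -/
def IsRetr {W X : C} (g : W ⟶ X) : Prop := ∃ s : X ⟶ W, s ≫ g = 𝟙 X

/-- `f` is a section. -/
def IsSect {X W : C} (f : X ⟶ W) : Prop := ∃ r : W ⟶ X, f ≫ r = 𝟙 X

theorem IsRetr.of_comp {V W X : C} {q : V ⟶ W} {g : W ⟶ X} (h : IsRetr (q ≫ g)) : IsRetr g := by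
  obtain ⟨s, hs⟩ := h
  exact ⟨s ≫ q, by simpa using hs⟩

theorem IsSect.of_comp {V W X : C} {f : X ⟶ W} {q : W ⟶ V} (h : IsSect (f ≫ q)) : IsSect f := by
  obtain ⟨s, hs⟩ := h
  exact ⟨q ≫ s, by simpa using hs⟩

theorem IsRetr.of_isIso {X : C} (a : X ⟶ X) (h : IsIso a) : IsRetr a := ⟨inv a, by simp⟩

theorem IsSect.of_isIso {X : C} (a : X ⟶ X) (h : IsIso a) : IsSect a := ⟨inv a, by simp⟩

theorem LocE.retr_add {X W : C} (h : LocE X) {f g : W ⟶ X} (hfg : IsRetr (f + g)) :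
    IsRetr f ∨ IsRetr g := by
  obtain ⟨s, hs⟩ := hfg
  rw [Preadditive.comp_add] at hs
  rcases h.2 _ _ hs with h | h
  · exact Or.inl (IsRetr.of_isIso _ h).of_comp
  · exact Or.inr (IsRetr.of_isIso _ h).of_comp

theorem LocE.sect_add {X W : C} (h : LocE X) {f g : X ⟶ W} (hfg : IsSect (f + g)) :
    IsSect f ∨ IsSect g := by
  obtain ⟨s, hs⟩ := hfg
  rw [Preadditive.add_comp] at hs
  rcases h.2 _ _ hs with h | h
  · exact Or.inl (IsSect.of_isIso _ h).of_comp
  · exact Or.inr (IsSect.of_isIso _ h).of_comp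

theorem LocE.zero_not_retr {X W : C} (h : LocE X) : ¬ IsRetr (0 : W ⟶ X) := by
  rintro ⟨s, hs⟩
  exact h.1 ((IsZero.iff_id_eq_zero X).2 (by simpa using hs.symm))

theorem LocE.zero_not_sect {X W : C} (h : LocE X) : ¬ IsSect (0 : X ⟶ W) := by
  rintro ⟨s, hs⟩
  exact h.1 ((IsZero.iff_id_eq_zero X).2 (by simpa using hs.symm))

/-- The subspace of non-retractions. -/
def nonRetr (K : Type w) [Field K] [Linear K C] {X : C} (h : LocE X) (W : C) :
    Submodule K (W ⟶ X) where
  carrier := {g | ¬ IsRetr g}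
  add_mem' {f g} hf hg hfg := (h.retr_add hfg).elim hf hg
  zero_mem' := h.zero_not_retr
  smul_mem' k g hg hkg := hg (IsRetr.of_comp (q := k • 𝟙 W) (by simpa using hkg))

/-- The subspace of non-sections. -/
def nonSect (K : Type w) [Field K] [Linear K C] {X : C} (h : LocE X) (W : C) :
    Submodule K (X ⟶ W) where
  carrier := {g | ¬ IsSect g}
  add_mem' {f g} hf hg hfg := (h.sect_add hfg).elim hf hg
  zero_mem' := h.zero_not_sect
  smul_mem' k g hg hkg := hg (IsSect.of_comp (q := k • 𝟙 W) (by simpa using hkg))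

end Loc

namespace ExtCat

variable {K : Type w} [Field K]
variable {C : Type u} [Category.{v} C] [Preadditive C] [HasFiniteBiproducts C]
variable {ξ : ExtCat K C}

theorem eq_zero_of_pull {a c w : C} {g : w ⟶ c} (hg : IsRetr g) {δ : ξ.Ext c a}
    (h : ξ.pull a g δ = 0) : δ = 0 := by
  obtain ⟨s, hs⟩ := hg
  rw [← ξ.pull_id a δ, ← hs, pull_comp, h, pull_zero_ext]

theorem eq_zero_of_push {a c w : C} {g : a ⟶ w} (hg : IsSect g) {δ : ξ.Ext c a}
    (h : ξ.push c g δ = 0) : δ = 0 := by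
  obtain ⟨s, hs⟩ := hg
  rw [← ξ.push_id c δ, ← hs, push_comp, h, push_zero_ext]

theorem retr_of_fix {a c : C} (hc : LocE c) {h : c ⟶ c} {δ : ξ.Ext c a} (hδ : δ ≠ 0)
    (hh : ξ.pull a h δ = δ) : IsIso h := by
  have hsum : h + (𝟙 c - h) = 𝟙 c := by abel
  rcases hc.2 _ _ hsum with h1 | h1
  · exact h1
  · exfalso
    apply hδ
    apply eq_zero_of_pull (IsRetr.of_isIso _ h1)
    have := ξ.pull_add a h (𝟙 c - h) δ
    rw [hsum, hh, pull_id] at this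
    simpa using this

theorem sect_of_fix {a c : C} (ha : LocE a) {h : a ⟶ a} {δ : ξ.Ext c a} (hδ : δ ≠ 0)
    (hh : ξ.push c h δ = δ) : IsIso h := by
  have hsum : h + (𝟙 a - h) = 𝟙 a := by abel
  rcases ha.2 _ _ hsum with h1 | h1
  · exact h1
  · exfalso
    apply hδ
    apply eq_zero_of_push (IsSect.of_isIso _ h1)
    have := ξ.push_add c h (𝟙 a - h) δ
    rw [hsum, hh, push_id] at this
    simpa using this

/-- Killing one non-retraction. -/
theorem kill_retr {a c w : C} (hc : LocE c) {δ : ξ.Ext c a} (hδ : δ ≠ 0) (g : w ⟶ c)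
    (hg : ¬ IsRetr g) :
    ∃ (a' : C) (k : a ⟶ a'), ξ.push c k δ ≠ 0 ∧ ξ.pull a' g (ξ.push c k δ) = 0 := by
  obtain ⟨b, x, y, hxy⟩ := ξ.real_exists δ
  obtain ⟨b', x', y', hxy'⟩ := ξ.real_exists (ξ.pull a g δ)
  refine ⟨b', x', ?_, ?_⟩
  · intro h0
    obtain ⟨m, hm⟩ := real_factor_left hxy x' h0
    obtain ⟨h, -, hh⟩ := ξ.et3 (𝟙 a) m hxy hxy' (by simpa using hm)
    have hh' : ξ.push c (𝟙 a) δ = ξ.pull a h (ξ.pull a g δ) := hh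
    rw [push_id, ← pull_comp] at hh'
    exact hg (IsRetr.of_isIso _ (retr_of_fix hc hδ hh'.symm)).of_comp
  · rw [← push_pull]
    exact real_push hxy'

/-- Killing one non-section. -/
theorem kill_sect {a c w : C} (ha : LocE a) {δ : ξ.Ext c a} (hδ : δ ≠ 0) (f : a ⟶ w)
    (hf : ¬ IsSect f) :
    ∃ (c' : C) (k : c' ⟶ c), ξ.pull a k δ ≠ 0 ∧ ξ.push c' f (ξ.pull a k δ) = 0 := by
  obtain ⟨b, x, y, hxy⟩ := ξ.real_exists δ
  obtain ⟨b', x', y', hxy'⟩ := ξ.real_exists (ξ.push c f δ)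
  refine ⟨b', y', ?_, ?_⟩
  · intro h0
    obtain ⟨m, hm⟩ := real_factor_right hxy y' h0
    obtain ⟨h, -, hh⟩ := ξ.et3op (𝟙 c) m hxy' hxy (by simpa using hm)
    have hh' : ξ.push c h (ξ.push c f δ) = ξ.pull a (𝟙 c) δ := hh
    rw [pull_id, ← push_comp] at hh'
    exact hf (IsSect.of_isIso _ (sect_of_fix ha hδ hh')).of_comp
  · rw [push_pull]
    exact real_pull hxy'

theorem kill_retr_finite {c : C} (hc : LocE c) {S : Set (Σ w : C, (w ⟶ c))} (hS : S.Finite)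
    (hS' : ∀ p ∈ S, ¬ IsRetr p.2) (hP : ∃ (a : C) (δ : ξ.Ext c a), δ ≠ 0) :
    ∃ (a : C) (δ : ξ.Ext c a), δ ≠ 0 ∧ ∀ p ∈ S, ξ.pull a p.2 δ = 0 := by
  induction S, hS using Set.Finite.induction_on with
  | empty =>
    obtain ⟨a, δ, h⟩ := hP
    exact ⟨a, δ, h, by simp⟩
  | @insert p S _ _ ih =>
    obtain ⟨a, δ, h, hk⟩ := ih (fun q hq => hS' q (Set.mem_insert_of_mem _ hq))
    obtain ⟨a', k, h1, h2⟩ := kill_retr hc h p.2 (hS' p (Set.mem_insert _ _))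
    refine ⟨a', _, h1, ?_⟩
    intro q hq
    rcases hq with rfl | hq
    · exact h2
    · rw [← push_pull, hk q hq, push_zero_ext]

theorem kill_sect_finite {a : C} (ha : LocE a) {S : Set (Σ w : C, (a ⟶ w))} (hS : S.Finite)
    (hS' : ∀ p ∈ S, ¬ IsSect p.2) (hP : ∃ (c : C) (δ : ξ.Ext c a), δ ≠ 0) :
    ∃ (c : C) (δ : ξ.Ext c a), δ ≠ 0 ∧ ∀ p ∈ S, ξ.push c p.2 δ = 0 := by
  induction S, hS using Set.Finite.induction_on with
  | empty =>
    obtain ⟨c, δ, h⟩ := hP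
    exact ⟨c, δ, h, by simp⟩
  | @insert p S _ _ ih =>
    obtain ⟨c, δ, h, hk⟩ := ih (fun q hq => hS' q (Set.mem_insert_of_mem _ hq))
    obtain ⟨c', k, h1, h2⟩ := kill_sect ha h p.2 (hS' p (Set.mem_insert _ _))
    refine ⟨c', _, h1, ?_⟩
    intro q hq
    rcases hq with rfl | hq
    · exact h2
    · rw [push_pull, hk q hq, pull_zero_ext]

theorem almostSplit_of_right {a c : C} (ha : LocE a) {δ : ξ.Ext c a} (hδ : δ ≠ 0)
    (h : ∀ {w : C} (g : w ⟶ c), ¬ IsRetr g → ξ.pull a g δ = 0) : ξ.AlmostSplit δ := by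
  refine ⟨hδ, ?_, fun g hg => h g hg⟩
  intro a' f hf
  by_contra hne
  obtain ⟨b, x, y, hxy⟩ := ξ.real_exists δ
  obtain ⟨b', x', y', hxy'⟩ := ξ.real_exists (ξ.push c f δ)
  have hy' : ¬ IsRetr y' := fun hr => hne (eq_zero_of_pull hr (real_pull hxy'))
  obtain ⟨m, hm⟩ := real_factor_right hxy y' (h y' hy')
  obtain ⟨k, -, hh⟩ := ξ.et3op (𝟙 c) m hxy' hxy (by simpa using hm)
  have hh' : ξ.push c k (ξ.push c f δ) = ξ.pull a (𝟙 c) δ := hh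
  rw [pull_id, ← push_comp] at hh'
  exact hf (IsSect.of_isIso _ (sect_of_fix ha hδ hh')).of_comp

theorem almostSplit_of_left {a c : C} (hc : LocE c) {δ : ξ.Ext c a} (hδ : δ ≠ 0)
    (h : ∀ {w : C} (f : a ⟶ w), ¬ IsSect f → ξ.push c f δ = 0) : ξ.AlmostSplit δ := by
  refine ⟨hδ, fun f hf => h f hf, ?_⟩
  intro c' g hg
  by_contra hne
  obtain ⟨b, x, y, hxy⟩ := ξ.real_exists δ
  obtain ⟨b', x', y', hxy'⟩ := ξ.real_exists (ξ.pull a g δ)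
  have hx' : ¬ IsSect x' := fun hr => hne (eq_zero_of_push hr (real_push hxy'))
  obtain ⟨m, hm⟩ := real_factor_left hxy x' (h x' hx')
  obtain ⟨k, -, hh⟩ := ξ.et3 (𝟙 a) m hxy hxy' (by simpa using hm)
  have hh' : ξ.push c (𝟙 a) δ = ξ.pull a k (ξ.pull a g δ) := hh
  rw [push_id, ← pull_comp] at hh'
  exact hg (IsRetr.of_isIso _ (retr_of_fix hc hδ hh'.symm)).of_comp

theorem exists_right [Linear K C] (hKS : IsKrullSchmidt C)
    (homFin : ∀ X Y : C, FiniteDimensional K (X ⟶ Y)) (hLF : LocFinite C)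
    (X : C) (hX : Indec X) (hP : ¬ ξ.ProjObj X) :
    ∃ (A : C) (δ : ξ.Ext X A), ξ.AlmostSplit δ := by
  have hL := hX.locE hKS
  obtain ⟨n, ind, hind⟩ := (hLF X hX).2
  have hfg : ∀ i, ∃ S : Finset (ind i ⟶ X), Submodule.span K (S : Set (ind i ⟶ X))
      = nonRetr K hL (ind i) := fun i => by
    haveI := homFin (ind i) X
    exact IsNoetherian.noetherian (nonRetr K hL (ind i))
  choose S hS using hfg
  let T : Set (Σ w : C, (w ⟶ X)) := ⋃ i, (Sigma.mk (ind i)) '' (S i : Set (ind i ⟶ X))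
  have hT : T.Finite := Set.finite_iUnion fun i => (S i).finite_toSet.image _
  have hT' : ∀ p ∈ T, ¬ IsRetr p.2 := by
    intro p hp
    obtain ⟨i, g, hg, rfl⟩ := Set.mem_iUnion.1 hp
    have : g ∈ nonRetr K hL (ind i) := by rw [← hS i]; exact Submodule.subset_span hg
    exact this
  have hP' : ∃ (a : C) (δ : ξ.Ext X a), δ ≠ 0 := by
    simpa [ProjObj] using hP
  obtain ⟨a, δ, hδ, hk⟩ := kill_retr_finite hL hT hT' hP'
  have key1 : ∀ (i : Fin n) (g : ind i ⟶ X), ¬ IsRetr g → ξ.pull a g δ = 0 := by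
    intro i g hg
    have hg' : g ∈ Submodule.span K (S i : Set (ind i ⟶ X)) := by rw [hS i]; exact hg
    clear hg
    induction hg' using Submodule.span_induction with
    | mem g hg => exact hk ⟨ind i, g⟩ (Set.mem_iUnion.2 ⟨i, g, hg, rfl⟩)
    | zero => exact ξ.pull_zero_hom a δ
    | add f g hf hg ihf ihg =>
      rw [pull_add, ihf, ihg, add_zero]
    | smul k g hg ih =>
      have : k • g = (k • 𝟙 (ind i)) ≫ g := by simp
      rw [this, pull_comp, ih, pull_zero_ext]
  have key2 : ∀ {w : C} (g : w ⟶ X), ¬ IsRetr g → ξ.pull a g δ = 0 := by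
    intro w g hg
    obtain ⟨m, f, p, q, hf, hpq⟩ := hKS.decomp w
    rw [← Category.id_comp g, ← hpq, Preadditive.sum_comp, pull_sum]
    refine Finset.sum_eq_zero fun j _ => ?_
    rw [Category.assoc, pull_comp]
    suffices h : ξ.pull a (q j ≫ g) δ = 0 by rw [h, pull_zero_ext]
    by_cases h0 : q j ≫ g = 0
    · rw [h0, pull_zero_hom]
    · obtain ⟨i, ⟨e⟩⟩ := hind (f j) (hf j).indec ⟨_, h0⟩
      have : q j ≫ g = e.hom ≫ (e.inv ≫ q j ≫ g) := by simp
      rw [this, pull_comp, key1 i _ fun h => hg h.of_comp.of_comp, pull_zero_ext]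
  obtain ⟨m, f, p, q, hf, hpq⟩ := hKS.decomp a
  have : ∃ j, ξ.push X (p j) δ ≠ 0 := by
    by_contra! hall
    apply hδ
    rw [← ξ.push_id X δ, ← hpq, push_sum]
    refine Finset.sum_eq_zero fun j _ => ?_
    rw [push_comp, hall j, push_zero_ext]
  obtain ⟨j, hj⟩ := this
  refine ⟨f j, _, almostSplit_of_right (hf j) hj ?_⟩
  intro w g hg
  rw [← push_pull, key2 g hg, push_zero_ext]

theorem exists_left [Linear K C] (hKS : IsKrullSchmidt C)
    (homFin : ∀ X Y : C, FiniteDimensional K (X ⟶ Y)) (hLF : LocFinite C)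
    (X : C) (hX : Indec X) (hP : ¬ ξ.InjObj X) :
    ∃ (A : C) (δ : ξ.Ext A X), ξ.AlmostSplit δ := by
  have hL := hX.locE hKS
  obtain ⟨n, ind, hind⟩ := (hLF X hX).1
  have hfg : ∀ i, ∃ S : Finset (X ⟶ ind i), Submodule.span K (S : Set (X ⟶ ind i))
      = nonSect K hL (ind i) := fun i => by
    haveI := homFin X (ind i)
    exact IsNoetherian.noetherian (nonSect K hL (ind i))
  choose S hS using hfg
  let T : Set (Σ w : C, (X ⟶ w)) := ⋃ i, (Sigma.mk (ind i)) '' (S i : Set (X ⟶ ind i))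
  have hT : T.Finite := Set.finite_iUnion fun i => (S i).finite_toSet.image _
  have hT' : ∀ p ∈ T, ¬ IsSect p.2 := by
    intro p hp
    obtain ⟨i, g, hg, rfl⟩ := Set.mem_iUnion.1 hp
    have : g ∈ nonSect K hL (ind i) := by rw [← hS i]; exact Submodule.subset_span hg
    exact this
  have hP' : ∃ (c : C) (δ : ξ.Ext c X), δ ≠ 0 := by
    simpa [InjObj] using hP
  obtain ⟨c, δ, hδ, hk⟩ := kill_sect_finite hL hT hT' hP'
  have key1 : ∀ (i : Fin n) (g : X ⟶ ind i), ¬ IsSect g → ξ.push c g δ = 0 := by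
    intro i g hg
    have hg' : g ∈ Submodule.span K (S i : Set (X ⟶ ind i)) := by rw [hS i]; exact hg
    clear hg
    induction hg' using Submodule.span_induction with
    | mem g hg => exact hk ⟨ind i, g⟩ (Set.mem_iUnion.2 ⟨i, g, hg, rfl⟩)
    | zero => exact ξ.push_zero_hom c δ
    | add f g hf hg ihf ihg =>
      rw [push_add, ihf, ihg, add_zero]
    | smul k g hg ih =>
      have : k • g = g ≫ (k • 𝟙 (ind i)) := by simp
      rw [this, push_comp, ih, push_zero_ext]
  have key2 : ∀ {w : C} (g : X ⟶ w), ¬ IsSect g → ξ.push c g δ = 0 := by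
    intro w g hg
    obtain ⟨m, f, p, q, hf, hpq⟩ := hKS.decomp w
    rw [← Category.comp_id g, ← hpq, Preadditive.comp_sum, push_sum]
    refine Finset.sum_eq_zero fun j _ => ?_
    rw [← Category.assoc, push_comp]
    suffices h : ξ.push c (g ≫ p j) δ = 0 by rw [h, push_zero_ext]
    by_cases h0 : g ≫ p j = 0
    · rw [h0, push_zero_hom]
    · obtain ⟨i, ⟨e⟩⟩ := hind (f j) (hf j).indec ⟨_, h0⟩
      have : g ≫ p j = ((g ≫ p j) ≫ e.hom) ≫ e.inv := by simp
      rw [this, push_comp, key1 i _ fun h => hg h.of_comp.of_comp, push_zero_ext]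
  obtain ⟨m, f, p, q, hf, hpq⟩ := hKS.decomp c
  have : ∃ j, ξ.pull X (q j) δ ≠ 0 := by
    by_contra! hall
    apply hδ
    rw [← ξ.pull_id X δ, ← hpq, pull_sum]
    refine Finset.sum_eq_zero fun j _ => ?_
    rw [pull_comp, hall j, pull_zero_ext]
  obtain ⟨j, hj⟩ := this
  refine ⟨f j, _, almostSplit_of_left (hf j) hj ?_⟩
  intro w g hg
  rw [push_pull, key2 g hg, pull_zero_ext]

end ExtCat

theorem stmt3 (K : Type w) [Field K] (C : Type u) [Category.{v} C] [Preadditive C]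
    [Linear K C] [HasFiniteBiproducts C] (hKS : IsKrullSchmidt C) (ξ : ExtCat K C)
    (homFin : ∀ X Y : C, FiniteDimensional K (X ⟶ Y))
    (extFin : ∀ X Y : C, FiniteDimensional K (ξ.Ext X Y))
    (hLF : LocFinite C) :
    (∀ X : C, Indec X → ¬ ξ.ProjObj X →
        ∃ (A B : C) (f : A ⟶ B) (g : B ⟶ X) (δ : ξ.Ext X A),
          ξ.real f g δ ∧ ξ.AlmostSplit δ) ∧
    (∀ X : C, Indec X → ¬ ξ.InjObj X →
        ∃ (A B : C) (f : X ⟶ B) (g : B ⟶ A) (δ : ξ.Ext A X),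
          ξ.real f g δ ∧ ξ.AlmostSplit δ) := by
  constructor
  · intro X hX hP
    obtain ⟨A, δ, hδ⟩ := ExtCat.exists_right hKS homFin hLF X hX hP
    obtain ⟨B, f, g, h⟩ := ξ.real_exists δ
    exact ⟨A, B, f, g, δ, h, hδ⟩
  · intro X hX hP
    obtain ⟨A, δ, hδ⟩ := ExtCat.exists_left hKS homFin hLF X hX hP
    obtain ⟨B, f, g, h⟩ := ξ.real_exists δ
    exact ⟨A, B, f, g, δ, h, hδ⟩
end
end

section
/- Let C be a Krull-Schmidt, Hom-finite, K-linear triangulated category (K a field) which has Auslander-Reiten triangles and a cluster tilting subcategory T, and let g : K_0(C,0) → K_0(C,T) be the canonical projection onto the relative Grothendieck group. Then Ker(g) is generated by the set {[l_X] | X ∈ Ind(C) \ T[1]} if and only if C is locally finite. -/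
open CategoryTheory CategoryTheory.Limits Opposite ZeroObject

attribute [local instance] CategoryTheory.Limits.hasBinaryBiproducts_of_finite_biproducts

universe w v u

noncomputable section

/-- `X` is a *dense* subcategory: `add X = C`, i.e. every object of `C` is a direct summand
of an object of `X`. -/
def DenseSub {C : Type u} [Category.{v} C] [Preadditive C] [HasFiniteBiproducts C]
    (X : Set C) : Prop :=
  ∀ A : C, ∃ X₀ ∈ X, ∃ B : C, Nonempty (X₀ ≅ A ⊞ B)

/-- `X` is a full additive subcategory closed under isomorphisms (given as a set of objects). -/
def AddSub (C : Type u) [Category.{v} C] [Preadditive C] [HasFiniteBiproducts C]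
    (X : Set C) : Prop :=
  (0 : C) ∈ X ∧ (∀ {A B : C}, A ∈ X → B ∈ X → (A ⊞ B) ∈ X) ∧
    (∀ {A B : C}, A ∈ X → Nonempty (A ≅ B) → B ∈ X)

section K0ZeroDefs

variable (C : Type u) [Category.{v} C] [Preadditive C] [HasFiniteBiproducts C]

/-- The relations `[A] + [B] - [A ⊞ B]` and `[A] - [B]` for `A ≅ B`, defining `K₀(C, 0)`. -/
def relAdd : Set (FreeAbelianGroup C) :=
  {x | (∃ A B : C,
          x = FreeAbelianGroup.of A + FreeAbelianGroup.of B - FreeAbelianGroup.of (A ⊞ B)) ∨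
       (∃ A B : C, Nonempty (A ≅ B) ∧ x = FreeAbelianGroup.of A - FreeAbelianGroup.of B)}

/-- `K₀(C, 0)`: the free abelian group on the isomorphism classes of objects of `C`. -/
abbrev K0Zero := FreeAbelianGroup C ⧸ AddSubgroup.closure (relAdd C)

/-- The class `[A]` of an object `A` in `K₀(C, 0)`. -/
def clsZero (A : C) : K0Zero C := QuotientAddGroup.mk (FreeAbelianGroup.of A)

end K0ZeroDefs

open CategoryTheory.Pretriangulated

section TriDefs

variable (C : Type u) [Category.{v} C] [Preadditive C] [HasZeroObject C] [HasShift C ℤ]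
  [∀ n : ℤ, (shiftFunctor C n).Additive] [Pretriangulated C] [HasFiniteBiproducts C]

/-- `T` is a cluster tilting subcategory of the triangulated category `C`. -/
structure IsClusterTilting (T : Set C) : Prop where
  sum_mem : ∀ {X Y : C}, X ∈ T → Y ∈ T → (X ⊞ Y) ∈ T
  summand_mem : ∀ {X Y Z : C}, Z ∈ T → Nonempty (Z ≅ X ⊞ Y) → X ∈ T
  contravariantly_finite : ∀ X : C, ∃ T₀ ∈ T, ∃ f : T₀ ⟶ X,
    ∀ T₁ ∈ T, ∀ g : T₁ ⟶ X, ∃ h : T₁ ⟶ T₀, h ≫ f = g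
  covariantly_finite : ∀ X : C, ∃ T₀ ∈ T, ∃ f : X ⟶ T₀,
    ∀ T₁ ∈ T, ∀ g : X ⟶ T₁, ∃ h : T₀ ⟶ T₁, f ≫ h = g
  char_left : ∀ X : C, X ∈ T ↔ ∀ T₀ ∈ T, ∀ φ : T₀ ⟶ X⟦(1 : ℤ)⟧, φ = 0
  char_right : ∀ X : C, X ∈ T ↔ ∀ T₀ ∈ T, ∀ φ : X ⟶ T₀⟦(1 : ℤ)⟧, φ = 0

/-- `X → Y → Z → X[1]` is an Auslander–Reiten triangle: a distinguished triangle with `X, Z`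
indecomposable, first map left almost split and second map right almost split. -/
structure IsARTriangle {X Y Z : C} (f : X ⟶ Y) (g : Y ⟶ Z) (h : Z ⟶ X⟦(1 : ℤ)⟧) : Prop where
  distinguished : Triangle.mk f g h ∈ distTriang C
  indec₁ : Indec X
  indec₃ : Indec Z
  not_section : ¬ ∃ r : Y ⟶ X, f ≫ r = 𝟙 X
  left_almost_split : ∀ {X' : C} (u : X ⟶ X'), (¬ ∃ r : X' ⟶ X, u ≫ r = 𝟙 X) →
    ∃ v : Y ⟶ X', f ≫ v = u
  not_retraction : ¬ ∃ s : Z ⟶ Y, s ≫ g = 𝟙 Z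
  right_almost_split : ∀ {W : C} (u : W ⟶ Z), (¬ ∃ s : Z ⟶ W, s ≫ u = 𝟙 Z) →
    ∃ v : W ⟶ Y, v ≫ g = u

/-- The shifted subcategory `T[1]` (closed under isomorphisms). -/
def shiftSet (T : Set C) : Set C := {W | ∃ t ∈ T, Nonempty (W ≅ t⟦(1 : ℤ)⟧)}

/-- `h` factors through an object of `T[1]`. -/
def FactorsThruShift (T : Set C) {Z X : C} (h : Z ⟶ X⟦(1 : ℤ)⟧) : Prop :=
  ∃ t ∈ T, ∃ (u : Z ⟶ t⟦(1 : ℤ)⟧) (v : t⟦(1 : ℤ)⟧ ⟶ X⟦(1 : ℤ)⟧), u ≫ v = h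

/-- The set of elements `[X] + [Z] - [Y]` of `K₀(C, 0)` for all distinguished triangles. -/
def triRel : Set (K0Zero C) :=
  {x | ∃ T : Triangle C, T ∈ (distTriang C) ∧
        x = clsZero C T.obj₁ + clsZero C T.obj₃ - clsZero C T.obj₂}

/-- The Grothendieck group `K₀(C)` of the triangulated category `C`. -/
abbrev K0Tri := K0Zero C ⧸ AddSubgroup.closure (triRel C)

/-- The canonical epimorphism `ψ : K₀(C, 0) → K₀(C)`. -/
def psiTri : K0Zero C →+ K0Tri C := QuotientAddGroup.mk' _

/-- The class `[A]` of an object `A` in `K₀(C)`. -/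
def k0clsTri (A : C) : K0Tri C := psiTri C (clsZero C A)

/-- The relations `[X] + [Z] - [Y]` for triangles `X → Y → Z --h--> X[1]` with `h` factoring
through an object of `T[1]`. -/
def relTriRel (T : Set C) : Set (K0Zero C) :=
  {x | ∃ Tr : Triangle C, Tr ∈ (distTriang C) ∧ FactorsThruShift C T Tr.mor₃ ∧
        x = clsZero C Tr.obj₁ + clsZero C Tr.obj₃ - clsZero C Tr.obj₂}

/-- The relative Grothendieck group `K₀(C, T)`. -/
abbrev K0RelTri (T : Set C) := K0Zero C ⧸ AddSubgroup.closure (relTriRel C T)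

/-- The canonical projection `g : K₀(C, 0) → K₀(C, T)`. -/
def gProj (T : Set C) : K0Zero C →+ K0RelTri C T := QuotientAddGroup.mk' _

/-- The set of elements `[δ] = [X] + [Z] - [Y]` of `K₀(C, 0)` arising from Auslander–Reiten
triangles `X → Y → Z → X[1]`; for the AR triangle starting at `X` this is `[l_X]`. -/
def arRelTri : Set (K0Zero C) :=
  {x | ∃ (X Y Z : C) (f : X ⟶ Y) (g : Y ⟶ Z) (h : Z ⟶ X⟦(1 : ℤ)⟧),
        IsARTriangle C f g h ∧ x = clsZero C X + clsZero C Z - clsZero C Y}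

/-- The set of elements `[l_X]` for `X ∈ Ind(C) \ T[1]`. -/
def arRelTriOff (T : Set C) : Set (K0Zero C) :=
  {x | ∃ (X Y Z : C) (f : X ⟶ Y) (g : Y ⟶ Z) (h : Z ⟶ X⟦(1 : ℤ)⟧),
        IsARTriangle C f g h ∧ X ∉ shiftSet C T ∧
        x = clsZero C X + clsZero C Z - clsZero C Y}

/-- `C` has Auslander–Reiten triangles: every indecomposable `X` admits an Auslander–Reiten
triangle `X → Y → τ⁻¹X → X[1]`. -/
def HasARTriangles : Prop :=
  ∀ X : C, Indec X →
    ∃ (Y Z : C) (f : X ⟶ Y) (g : Y ⟶ Z) (h : Z ⟶ X⟦(1 : ℤ)⟧), IsARTriangle C f g h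

/-- `add T₀`: the objects isomorphic to direct summands of finite direct sums of copies
of `T₀`. -/
def addSet (T₀ : C) : Set C :=
  {X | ∃ (n : ℕ) (Y : C), Nonempty ((⨁ fun _ : Fin n => T₀) ≅ X ⊞ Y)}

/-- `Ind(C)` is finite: there are finitely many indecomposables up to isomorphism. -/
def FinitelyManyIndec : Prop :=
  ∃ (n : ℕ) (ind : Fin n → C), ∀ X : C, Indec X → ∃ i, Nonempty (X ≅ ind i)

end TriDefs

set_option linter.unusedSectionVars false

section Basics

variable {C : Type u} [Category.{v} C] [Preadditive C] [HasFiniteBiproducts C]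

/-- local endomorphism ring, elementary form -/
def LocEnd (A : C) : Prop :=
  𝟙 A ≠ 0 ∧ ∀ a b : A ⟶ A, a + b = 𝟙 A → IsIso a ∨ IsIso b

lemma locEnd_of_isLocalRing {A : C} (h : IsLocalRing (CategoryTheory.End A)) : LocEnd A := by
  refine ⟨fun h0 => ?_, fun a b hab => ?_⟩
  · exact one_ne_zero (α := CategoryTheory.End A) h0
  · have := IsLocalRing.isUnit_or_isUnit_of_add_one (R := CategoryTheory.End A) (a := a) (b := b) hab
    simpa only [isUnit_iff_isIso] using this

lemma LocEnd.of_iso {A B : C} (h : LocEnd A) (e : A ≅ B) : LocEnd B := by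
  refine ⟨fun h0 => h.1 ?_, fun a b hab => ?_⟩
  · calc 𝟙 A = e.hom ≫ 𝟙 B ≫ e.inv := by simp
      _ = 0 := by rw [h0]; simp
  · have := h.2 (e.hom ≫ a ≫ e.inv) (e.hom ≫ b ≫ e.inv) (by
      rw [← Preadditive.comp_add, ← Preadditive.add_comp, hab]; simp)
    have key : ∀ c : B ⟶ B, IsIso (e.hom ≫ c ≫ e.inv) → IsIso c := by
      intro c hc
      have : c = e.inv ≫ (e.hom ≫ c ≫ e.inv) ≫ e.hom := by simp
      rw [this]; infer_instance
    exact this.imp (key a) (key b)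

lemma LocEnd.not_isZero {A : C} (h : LocEnd A) : ¬ IsZero A := fun hz => h.1 (hz.eq_of_src _ _)

/-- an idempotent in a local endomorphism ring -/
lemma LocEnd.idem {A : C} (h : LocEnd A) (p : A ⟶ A) (hp : p ≫ p = p) : p = 0 ∨ p = 𝟙 A := by
  rcases h.2 p (𝟙 A - p) (by abel) with h1 | h1
  · right; rw [← cancel_epi p, hp]; simp
  · left; rw [← cancel_epi (𝟙 A - p)]; simp [hp]

lemma LocEnd.indec {A : C} (h : LocEnd A) : Indec A := by
  refine ⟨h.not_isZero, fun Y Z ⟨e⟩ => ?_⟩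
  rcases h.idem (e.hom ≫ biprod.fst ≫ biprod.inl ≫ e.inv) (by simp) with h1 | h1
  · left
    rw [IsZero.iff_id_eq_zero]
    have : biprod.inl ≫ e.inv ≫ (e.hom ≫ biprod.fst ≫ biprod.inl ≫ e.inv) ≫ e.hom ≫ biprod.fst
      = 𝟙 Y := by simp
    rw [← this, h1]; simp
  · right
    rw [IsZero.iff_id_eq_zero]
    have : biprod.inr ≫ e.inv ≫ (e.hom ≫ biprod.fst ≫ biprod.inl ≫ e.inv) ≫ e.hom ≫ biprod.snd
      = 0 := by simp
    rw [h1] at this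
    simpa using this

/-- a section (or retraction) between indecomposables is an isomorphism -/
lemma LocEnd.iso_of_section {A B : C} (hA : LocEnd A) (hB : LocEnd B) (s : A ⟶ B) (r : B ⟶ A)
    (h : s ≫ r = 𝟙 A) : Nonempty (A ≅ B) := by
  have h2 : (r ≫ s) ≫ (r ≫ s) = r ≫ s := by
    rw [Category.assoc, reassoc_of% h]
  rcases hB.idem _ h2 with h1 | h1
  · exfalso; apply hA.1
    calc 𝟙 A = (s ≫ r) ≫ (s ≫ r) := by rw [h]; simp
      _ = s ≫ (r ≫ s) ≫ r := by simp
      _ = 0 := by rw [h1]; simp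
  · exact ⟨⟨s, r, h, h1⟩⟩

/-- the class in K0 -/
lemma cls_iso {A B : C} (e : A ≅ B) : clsZero C A = clsZero C B := by
  unfold clsZero
  rw [QuotientAddGroup.eq_iff_sub_mem]
  exact AddSubgroup.subset_closure (Or.inr ⟨A, B, ⟨e⟩, rfl⟩)

lemma cls_biprod (A B : C) : clsZero C (A ⊞ B) = clsZero C A + clsZero C B := by
  symm
  unfold clsZero
  rw [← QuotientAddGroup.mk_add, QuotientAddGroup.eq_iff_sub_mem]
  exact AddSubgroup.subset_closure (Or.inl ⟨A, B, rfl⟩)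

lemma cls_zero {A : C} (h : IsZero A) : clsZero C A = 0 := by
  have e : A ≅ A ⊞ A :=
    { hom := 0, inv := 0, hom_inv_id := h.eq_of_src _ _,
      inv_hom_id := by ext <;> exact h.eq_of_src _ _ }
  have := cls_iso e
  rw [cls_biprod] at this
  simpa using this

/-- lifting an additive function on objects to `K0Zero`. -/
def k0lift (φ : C → ℤ) (h1 : ∀ A B, φ (A ⊞ B) = φ A + φ B) (h2 : ∀ A B, (A ≅ B) → φ A = φ B) :
    K0Zero C →+ ℤ :=
  QuotientAddGroup.lift _ (FreeAbelianGroup.lift φ) (by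
    rw [AddSubgroup.closure_le]
    rintro x (⟨A, B, rfl⟩ | ⟨A, B, ⟨e⟩, rfl⟩)
    · simp [h1]
    · simp [h2 A B e])

lemma k0lift_cls (φ : C → ℤ) (h1) (h2) (A : C) : k0lift φ h1 h2 (clsZero C A) = φ A := by
  unfold k0lift clsZero
  erw [QuotientAddGroup.lift_mk]
  simp

end Basics

section LinAlg

open Module

lemma linalg_count {K V V0 U : Type*} [Field K] [AddCommGroup V]
    [AddCommGroup V0] [AddCommGroup U] [Module K V] [Module K V0] [Module K U]
    [FiniteDimensional K V] [FiniteDimensional K V0] [FiniteDimensional K U]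
    (p : V →ₗ[K] U) (i : V0 →ₗ[K] V) (hpi : LinearMap.range i = LinearMap.ker p)
    (R : Submodule K V) :
    (finrank K V : ℤ) - finrank K R = finrank K (LinearMap.range p) + finrank K V0
      - finrank K (R.map p) - finrank K (R.comap i) := by
  have e1 := LinearMap.finrank_range_add_finrank_ker p
  have e2 := LinearMap.finrank_range_add_finrank_ker i
  have e3 := LinearMap.finrank_range_add_finrank_ker (p.domRestrict R)
  have e4 := LinearMap.finrank_range_add_finrank_ker (i.domRestrict (R.comap i))
  have f1 : LinearMap.range (p.domRestrict R) = R.map p := LinearMap.range_domRestrict _ _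
  have f2 : LinearMap.range (i.domRestrict (R.comap i)) = R ⊓ LinearMap.ker p := by
    rw [LinearMap.range_domRestrict, Submodule.map_comap_eq, hpi, inf_comm]
  have f3 : finrank K (LinearMap.ker (p.domRestrict R)) = finrank K ↥(R ⊓ LinearMap.ker p) := by
    rw [LinearMap.ker_domRestrict]
    rw [← Submodule.map_comap_subtype]
    exact (LinearEquiv.finrank_eq (Submodule.equivMapOfInjective _ R.injective_subtype _))
  have f4 : finrank K (LinearMap.ker (i.domRestrict (R.comap i))) = finrank K (LinearMap.ker i) := by
    rw [LinearMap.ker_domRestrict]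
    rw [LinearEquiv.finrank_eq (Submodule.equivMapOfInjective _ (R.comap i).injective_subtype _)]
    rw [Submodule.map_comap_subtype, inf_eq_right.2]
    intro x hx
    have : i x = 0 := hx
    simp [this]
  rw [f1] at e3
  rw [f2, f4] at e4
  rw [f3] at e3
  rw [hpi] at e2
  omega

end LinAlg

section Mult

open Module

variable {C : Type u} [Category.{v} C] [Preadditive C] [HasFiniteBiproducts C]
  (K : Type w) [Field K] [Linear K C]

/-- the radical morphisms from an object with local endomorphism ring -/
def radHom {A : C} (hA : LocEnd A) (X : C) : Submodule K (A ⟶ X) where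
  carrier := {u | ¬ ∃ r : X ⟶ A, u ≫ r = 𝟙 A}
  zero_mem' := by
    rintro ⟨r, hr⟩
    exact hA.1 (by rw [← hr]; simp)
  add_mem' := by
    rintro a b ha hb ⟨r, hr⟩
    rw [Preadditive.add_comp] at hr
    rcases hA.2 _ _ hr with h | h
    · exact ha ⟨r ≫ inv (a ≫ r), by rw [← Category.assoc]; simp⟩
    · exact hb ⟨r ≫ inv (b ≫ r), by rw [← Category.assoc]; simp⟩
  smul_mem' := by
    rintro c x hx ⟨r, hr⟩
    exact hx ⟨c • r, by rw [Linear.comp_smul, ← Linear.smul_comp, hr]⟩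

lemma mem_radHom {A : C} (hA : LocEnd A) {X : C} (u : A ⟶ X) :
    u ∈ radHom K hA X ↔ ¬ ∃ r : X ⟶ A, u ≫ r = 𝟙 A := Iff.rfl

lemma radHom_comp {A : C} (hA : LocEnd A) {X Y : C} (u : A ⟶ X) (m : X ⟶ Y)
    (hu : u ∈ radHom K hA X) : u ≫ m ∈ radHom K hA Y := by
  rintro ⟨r, hr⟩
  exact hu ⟨m ≫ r, by simpa using hr⟩

/-- the multiplicity of `A` in `X` (times a constant) -/
def muMult {A : C} (hA : LocEnd A) (X : C) : ℤ :=
  (finrank K (A ⟶ X) : ℤ) - finrank K (radHom K hA X)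

/-- `Hom(A, X ⊞ Y) = Hom(A, X) × Hom(A, Y)` -/
def homBiprodEquiv (A X Y : C) : (A ⟶ X ⊞ Y) ≃ₗ[K] (A ⟶ X) × (A ⟶ Y) where
  toFun u := (u ≫ biprod.fst, u ≫ biprod.snd)
  invFun p := biprod.lift p.1 p.2
  map_add' := by intros; simp
  map_smul' := by intros; simp
  left_inv := by intro u; ext <;> simp
  right_inv := by rintro ⟨a, b⟩; simp

/-- `Hom(X ⊞ Y, A) = Hom(X, A) × Hom(Y, A)` -/
def biprodHomEquiv (X Y A : C) : (X ⊞ Y ⟶ A) ≃ₗ[K] (X ⟶ A) × (Y ⟶ A) where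
  toFun u := (biprod.inl ≫ u, biprod.inr ≫ u)
  invFun p := biprod.desc p.1 p.2
  map_add' := by intros; simp
  map_smul' := by intros; simp
  left_inv := by intro u; ext <;> simp
  right_inv := by rintro ⟨a, b⟩; simp

lemma muMult_biprod (homFin : ∀ X Y : C, FiniteDimensional K (X ⟶ Y))
    {A : C} (hA : LocEnd A) (X Y : C) :
    muMult K hA (X ⊞ Y) = muMult K hA X + muMult K hA Y := by
  have := homFin
  have e1 : finrank K (A ⟶ X ⊞ Y) = finrank K (A ⟶ X) + finrank K (A ⟶ Y) := by
    rw [(homBiprodEquiv K A X Y).finrank_eq, finrank_prod]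
  have e2 : finrank K (radHom K hA (X ⊞ Y)) = finrank K (radHom K hA X) +
      finrank K (radHom K hA Y) := by
    let e : radHom K hA (X ⊞ Y) ≃ₗ[K] radHom K hA X × radHom K hA Y :=
      { toFun := fun u => (⟨u.1 ≫ biprod.fst, radHom_comp K hA _ _ u.2⟩,
          ⟨u.1 ≫ biprod.snd, radHom_comp K hA _ _ u.2⟩)
        invFun := fun p => ⟨p.1.1 ≫ biprod.inl + p.2.1 ≫ biprod.inr,
          (radHom K hA _).add_mem (radHom_comp K hA _ _ p.1.2) (radHom_comp K hA _ _ p.2.2)⟩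
        map_add' := by intros; ext <;> simp
        map_smul' := by intros; ext <;> simp
        left_inv := by intro u; ext <;> simp
        right_inv := by rintro ⟨a, b⟩; ext <;> simp }
    rw [e.finrank_eq, finrank_prod]
  unfold muMult
  rw [e1, e2]; push_cast; ring

lemma muMult_pos_iff (homFin : ∀ X Y : C, FiniteDimensional K (X ⟶ Y))
    {A : C} (hA : LocEnd A) (X : C) :
    muMult K hA X ≠ 0 ↔ ∃ (s : A ⟶ X) (r : X ⟶ A), s ≫ r = 𝟙 A := by
  have := homFin
  have : muMult K hA X = 0 ↔ radHom K hA X = ⊤ := by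
    unfold muMult
    constructor
    · intro h
      apply Submodule.eq_top_of_finrank_eq
      omega
    · intro h; rw [h, finrank_top]; simp
  rw [Ne, not_congr this, Submodule.eq_top_iff']
  simp only [mem_radHom]
  push Not
  rfl

lemma muMult_iso (homFin : ∀ X Y : C, FiniteDimensional K (X ⟶ Y))
    {A : C} (hA : LocEnd A) {X Y : C} (e : X ≅ Y) :
    muMult K hA X = muMult K hA Y := by
  have := homFin
  have := linalg_count (K := K) (V := A ⟶ X) (V0 := A ⟶ X) (U := A ⟶ Y)
    (Linear.rightComp K A e.hom) 0 (by
      rw [LinearMap.range_zero, eq_comm, LinearMap.ker_eq_bot]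
      intro a b hab
      simpa using hab) (radHom K hA X)
  have h1 : LinearMap.range (Linear.rightComp K A e.hom) = ⊤ := by
    rw [LinearMap.range_eq_top]
    intro a
    exact ⟨a ≫ e.inv, by simp⟩
  have h2 : (radHom K hA X).map (Linear.rightComp K A e.hom) = radHom K hA Y := by
    ext a
    constructor
    · rintro ⟨b, hb, rfl⟩
      exact radHom_comp K hA _ _ hb
    · intro ha
      exact ⟨a ≫ e.inv, radHom_comp K hA _ _ ha, by simp⟩
  unfold muMult
  rw [this, h1, h2, Submodule.comap_zero, finrank_top, finrank_top]
  ring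

end Mult

section TriLemmas

open Module

variable {C : Type u} [Category.{v} C] [Preadditive C] [HasZeroObject C] [HasShift C ℤ]
  [∀ n : ℤ, (shiftFunctor C n).Additive] [Pretriangulated C] [HasFiniteBiproducts C]

lemma ex1 {X Y Z : C} {f : X ⟶ Y} {g : Y ⟶ Z} {h : Z ⟶ X⟦(1 : ℤ)⟧}
    (D : Triangle.mk f g h ∈ distTriang C) {A : C} (q : X ⟶ A) (hq : h ≫ q⟦(1 : ℤ)⟧' = 0) :
    ∃ r : Y ⟶ A, f ≫ r = q := by
  obtain ⟨b, hb, -⟩ := complete_distinguished_triangle_morphism₂ _ _ D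
    (contractible_distinguished A) q 0 (by
      change h ≫ q⟦(1 : ℤ)⟧' = 0 ≫ 0
      simp [hq])
  exact ⟨b, hb.trans (Category.comp_id q)⟩

lemma ex1' {X Y Z : C} {f : X ⟶ Y} {g : Y ⟶ Z} {h : Z ⟶ X⟦(1 : ℤ)⟧}
    (D : Triangle.mk f g h ∈ distTriang C) : h ≫ f⟦(1 : ℤ)⟧' = 0 :=
  comp_distTriang_mor_zero₃₁ _ D

lemma ex12 {X Y Z : C} {f : X ⟶ Y} {g : Y ⟶ Z} {h : Z ⟶ X⟦(1 : ℤ)⟧}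
    (D : Triangle.mk f g h ∈ distTriang C) : f ≫ g = 0 :=
  comp_distTriang_mor_zero₁₂ _ D

lemma ex23 {X Y Z : C} {f : X ⟶ Y} {g : Y ⟶ Z} {h : Z ⟶ X⟦(1 : ℤ)⟧}
    (D : Triangle.mk f g h ∈ distTriang C) : g ≫ h = 0 :=
  comp_distTriang_mor_zero₂₃ _ D

lemma yo2 {X Y Z : C} {f : X ⟶ Y} {g : Y ⟶ Z} {h : Z ⟶ X⟦(1 : ℤ)⟧}
    (D : Triangle.mk f g h ∈ distTriang C) {A : C} (q : Y ⟶ A) (hq : f ≫ q = 0) :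
    ∃ r : Z ⟶ A, q = g ≫ r := Triangle.yoneda_exact₂ _ D q hq

lemma yo3 {X Y Z : C} {f : X ⟶ Y} {g : Y ⟶ Z} {h : Z ⟶ X⟦(1 : ℤ)⟧}
    (D : Triangle.mk f g h ∈ distTriang C) {A : C} (q : Z ⟶ A) (hq : g ≫ q = 0) :
    ∃ r : X⟦(1 : ℤ)⟧ ⟶ A, q = h ≫ r := Triangle.yoneda_exact₃ _ D q hq

lemma co2 {X Y Z : C} {f : X ⟶ Y} {g : Y ⟶ Z} {h : Z ⟶ X⟦(1 : ℤ)⟧}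
    (D : Triangle.mk f g h ∈ distTriang C) {A : C} (q : A ⟶ Y) (hq : q ≫ g = 0) :
    ∃ r : A ⟶ X, q = r ≫ f := Triangle.coyoneda_exact₂ _ D q hq

lemma co3 {X Y Z : C} {f : X ⟶ Y} {g : Y ⟶ Z} {h : Z ⟶ X⟦(1 : ℤ)⟧}
    (D : Triangle.mk f g h ∈ distTriang C) {A : C} (q : A ⟶ Z) (hq : q ≫ h = 0) :
    ∃ r : A ⟶ Y, q = r ≫ g := Triangle.coyoneda_exact₃ _ D q hq

lemma co1 {X Y Z : C} {f : X ⟶ Y} {g : Y ⟶ Z} {h : Z ⟶ X⟦(1 : ℤ)⟧}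
    (D : Triangle.mk f g h ∈ distTriang C) {A : C} (q : A ⟶ X⟦(1 : ℤ)⟧)
    (hq : q ≫ f⟦(1 : ℤ)⟧' = 0) :
    ∃ r : A ⟶ Z, q = r ≫ h := Triangle.coyoneda_exact₁ _ D q hq

lemma tri_map {X Y Z X1 W : C} {f : X ⟶ Y} {g : Y ⟶ Z} {h : Z ⟶ X⟦(1 : ℤ)⟧}
    (D : Triangle.mk f g h ∈ distTriang C)
    {φ : X ⟶ X1} {β : X1 ⟶ W} {γ : W ⟶ X⟦(1 : ℤ)⟧} (D' : Triangle.mk φ β γ ∈ distTriang C)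
    (y : X1 ⟶ Y) (hy : φ ≫ y = f) : ∃ w : W ⟶ Z, β ≫ w = y ≫ g ∧ γ = w ≫ h := by
  obtain ⟨w, hw1, hw2⟩ := complete_distinguished_triangle_morphism _ _ D' D (𝟙 X) y
    (hy.trans (Category.id_comp f).symm)
  refine ⟨w, hw1, ?_⟩
  refine Eq.trans ?_ hw2
  change γ = γ ≫ (shiftFunctor C (1 : ℤ)).map (𝟙 X)
  simp

lemma tri_split {X Y Z : C} {f : X ⟶ Y} {g : Y ⟶ Z}
    (D : Triangle.mk f g (0 : Z ⟶ X⟦(1 : ℤ)⟧) ∈ distTriang C) :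
    ∃ e : Y ≅ X ⊞ Z, f ≫ e.hom = biprod.inl := by
  obtain ⟨e, he, -⟩ := exists_iso_binaryBiproduct_of_distTriang _ D rfl
  exact ⟨e, he⟩

/-- a split mono splits -/
lemma split_mono' {A X : C} (s : A ⟶ X) (r : X ⟶ A) (h : s ≫ r = 𝟙 A) :
    ∃ (X' : C) (π : X ⟶ X') (e : X ≅ A ⊞ X'), Triangle.mk s π (0 : X' ⟶ A⟦(1 : ℤ)⟧) ∈ distTriang C ∧
      s ≫ e.hom = biprod.inl := by
  obtain ⟨X', π, c, D⟩ := distinguished_cocone_triangle s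
  have hc : c = 0 := by
    have h1 := ex1' D
    calc c = c ≫ (𝟙 A)⟦(1 : ℤ)⟧' := by simp
      _ = (c ≫ s⟦(1 : ℤ)⟧') ≫ r⟦(1 : ℤ)⟧' := by rw [← h]; simp
      _ = 0 := by rw [h1]; simp
  subst hc
  obtain ⟨e, he⟩ := tri_split D
  exact ⟨X', π, e, D, he⟩

/-- a split epi splits -/
lemma split_epi' {A X : C} (s : A ⟶ X) (r : X ⟶ A) (h : s ≫ r = 𝟙 A) :
    ∃ (X' : C) (ι : X' ⟶ X) (ρ : X ⟶ X') (_ : X ≅ X' ⊞ A),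
      Triangle.mk ι r (0 : A ⟶ X'⟦(1 : ℤ)⟧) ∈ distTriang C ∧ ι ≫ ρ = 𝟙 X' := by
  obtain ⟨X', ι, c, D⟩ := distinguished_cocone_triangle₁ r
  have hc : c = 0 := by
    have h1 := ex23 D
    calc c = s ≫ r ≫ c := by rw [reassoc_of% h]
      _ = 0 := by rw [h1]; simp
  subst hc
  obtain ⟨e, he⟩ := tri_split D
  refine ⟨X', ι, e.hom ≫ biprod.fst, e, D, ?_⟩
  rw [reassoc_of% he]; simp

lemma exists_comp (hKS : IsKrullSchmidt C) (X : C) : ∃ (n : ℕ) (f : Fin n → C) (_ : X ≅ ⨁ f),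
    ∀ i, LocEnd (f i) := by
  obtain ⟨n, f, hf, ⟨e⟩⟩ := hKS X
  exact ⟨n, f, e, fun i => locEnd_of_isLocalRing (hf i)⟩

lemma Indec.locEnd (hKS : IsKrullSchmidt C) {X : C} (hX : Indec X) : LocEnd X := by
  obtain ⟨n, f, e, hf⟩ := exists_comp hKS X
  have : ∃ j : Fin n, True := by
    by_contra hn
    push Not at hn
    apply hX.1
    rw [IsZero.iff_id_eq_zero, ← cancel_mono e.hom]
    apply biproduct.hom_ext
    intro j
    exact (hn j).elim
  obtain ⟨j, -⟩ := this
  obtain ⟨X', π, e', -, -⟩ := split_mono' (biproduct.ι f j ≫ e.inv) (e.hom ≫ biproduct.π f j)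
    (by simp)
  rcases hX.2 _ _ ⟨e'⟩ with h | h
  · exact ((hf j).not_isZero h).elim
  · refine (hf j).of_iso ?_
    refine ⟨biprod.inl ≫ e'.inv, e'.hom ≫ biprod.fst, by simp, ?_⟩
    rw [← cancel_epi e'.inv, ← cancel_mono e'.hom]
    ext
    · simp
    · simp
    · exact h.eq_of_src _ _
    · exact h.eq_of_src _ _

variable (K : Type w) [Field K] [Linear K C]

lemma cls_eq_of_mu (hKS : IsKrullSchmidt C) (homFin : ∀ X Y : C, FiniteDimensional K (X ⟶ Y))
    (X X' : C) (h : ∀ (A : C) (hA : LocEnd A), muMult K hA X = muMult K hA X') :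
    clsZero C X = clsZero C X' := by
  obtain ⟨n, f, e, hf⟩ := exists_comp hKS X
  induction n generalizing X X' with
  | zero =>
    have hX : IsZero X := by
      rw [IsZero.iff_id_eq_zero, ← cancel_mono e.hom]
      apply biproduct.hom_ext
      intro j
      exact j.elim0
    have hX' : IsZero X' := by
      obtain ⟨n, f', e', hf'⟩ := exists_comp hKS X'
      rw [IsZero.iff_id_eq_zero, ← cancel_mono e'.hom]
      apply biproduct.hom_ext
      intro j
      exfalso
      have h1 := (muMult_pos_iff K homFin (hf' j) X').2
        ⟨biproduct.ι f' j ≫ e'.inv, e'.hom ≫ biproduct.π f' j, by simp⟩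
      rw [← h, muMult_pos_iff K homFin] at h1
      obtain ⟨s, r, hsr⟩ := h1
      apply (hf' j).1
      rw [← hsr, hX.eq_of_tgt s 0]; simp
    rw [cls_zero hX, cls_zero hX']
  | succ n ih =>
    have h1 := (muMult_pos_iff K homFin (hf 0) X).2
        ⟨biproduct.ι f 0 ≫ e.inv, e.hom ≫ biproduct.π f 0, by simp⟩
    rw [h, muMult_pos_iff K homFin] at h1
    obtain ⟨s, r, hsr⟩ := h1
    obtain ⟨X1, π, e1, -, -⟩ := split_mono' s r hsr
    have e2 : X ≅ f 0 ⊞ ⨁ (fun i : Fin n => f i.succ) := e ≪≫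
      { hom := biprod.lift (biproduct.π f 0) (biproduct.lift fun i => biproduct.π f i.succ)
        inv := biprod.desc (biproduct.ι f 0) (biproduct.desc fun i => biproduct.ι f i.succ)
        hom_inv_id := by
          rw [biprod.lift_desc, biproduct.lift_desc, ← biproduct.total, Fin.sum_univ_succ]
        inv_hom_id := by
          apply biprod.hom_ext'
          · apply biprod.hom_ext
            · simp
            · apply biproduct.hom_ext
              intro j
              simp [biproduct.ι_π_ne _ (Fin.succ_ne_zero j).symm]
          · apply biproduct.hom_ext'
            intro i
            apply biprod.hom_ext
            · simp [biproduct.ι_π_ne _ (Fin.succ_ne_zero i)]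
            · apply biproduct.hom_ext
              intro j
              by_cases hij : i = j
              · subst hij; simp
              · simp [biproduct.ι_π_ne _ hij,
                  biproduct.ι_π_ne f (fun hh => hij (Fin.succ_injective _ hh))] }
    rw [cls_iso e2, cls_iso e1, cls_biprod, cls_biprod]
    congr 1
    refine ih _ _ ?_ _ (Iso.refl _) (fun i => hf i.succ)
    intro A hA
    have := h A hA
    rw [muMult_iso K homFin hA e2, muMult_iso K homFin hA e1, muMult_biprod K homFin,
      muMult_biprod K homFin] at this
    linarith

/-- The key lemma replacing the octahedron on the level of `K₀(C,0)`. -/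
lemma push_lemma (hKS : IsKrullSchmidt C) (homFin : ∀ X Y : C, FiniteDimensional K (X ⟶ Y))
    {X Y Z X1 W Y1 : C} {f : X ⟶ Y} {g : Y ⟶ Z} {h : Z ⟶ X⟦(1 : ℤ)⟧}
    (D : Triangle.mk f g h ∈ distTriang C)
    {φ : X ⟶ X1} {β : X1 ⟶ W} {γ : W ⟶ X⟦(1 : ℤ)⟧} (D' : Triangle.mk φ β γ ∈ distTriang C)
    (y : X1 ⟶ Y) (hy : φ ≫ y = f)
    {x1 : X1 ⟶ Y1} {g1 : Y1 ⟶ Z} (D1 : Triangle.mk x1 g1 (h ≫ φ⟦(1 : ℤ)⟧') ∈ distTriang C) :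
    clsZero C Y1 = clsZero C Y + clsZero C W := by
  have := homFin
  obtain ⟨w, hw1, hw2⟩ := tri_map D D' y hy
  rw [← cls_biprod]
  apply cls_eq_of_mu K hKS homFin
  intro A hA
  let i : X1 ⟶ Y ⊞ W := biprod.lift y β
  let p : Y ⊞ W ⟶ Z := biprod.desc g (-w)
  have hip : i ≫ p = 0 := by simp [i, p, hw1]
  -- exactness at Z
  have hph : p ≫ h ≫ φ⟦(1 : ℤ)⟧' = 0 := by
    have h1 := ex23 D
    have h2 := ex1' D'
    rw [hw2, Category.assoc] at h2
    apply biprod.hom_ext'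
    · simp [p, reassoc_of% h1]
    · simp [p, h2]
  have exZ : ∀ {B : C} (s : B ⟶ Z), s ≫ h ≫ φ⟦(1 : ℤ)⟧' = 0 → ∃ k : B ⟶ Y ⊞ W, k ≫ p = s := by
    intro B s hs
    obtain ⟨t, ht⟩ := co1 D' (s ≫ h) (by simpa using hs)
    obtain ⟨k, hk⟩ := co3 D (s - t ≫ w) (by
      rw [Preadditive.sub_comp, ht, hw2]; simp)
    refine ⟨biprod.lift k (-t), ?_⟩
    simp [p, ← hk]
  obtain ⟨m, hm⟩ := co3 D1 p hph
  obtain ⟨n, hn⟩ := exZ g1 (ex23 D1)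
  have c1 := linalg_count (K := K) (Linear.rightComp K A g1) (Linear.rightComp K A x1) (by
    ext u
    constructor
    · rintro ⟨v, rfl⟩
      have := ex12 D1
      simp [this]
    · intro hu
      obtain ⟨v, hv⟩ := co2 D1 u hu
      exact ⟨v, hv.symm⟩) (radHom K hA Y1)
  have c2 := linalg_count (K := K) (Linear.rightComp K A p) (Linear.rightComp K A i) (by
    ext u
    constructor
    · rintro ⟨v, rfl⟩
      simp [hip]
    · intro hu
      have hu' : u ≫ p = 0 := hu
      have hu2 : (u ≫ biprod.fst) ≫ g = (u ≫ biprod.snd) ≫ w := by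
        have : u = biprod.lift (u ≫ biprod.fst) (u ≫ biprod.snd) := by ext <;> simp
        rw [this] at hu'
        simp only [p, biprod.lift_desc, Preadditive.comp_neg] at hu'
        exact sub_eq_zero.1 (by rw [sub_eq_add_neg]; exact hu')
      have h1 := ex23 D
      obtain ⟨v, hv⟩ := co3 D' (u ≫ biprod.snd) (by
        rw [hw2, ← Category.assoc, ← hu2, Category.assoc, h1]; simp)
      obtain ⟨k, hk⟩ := co2 D (u ≫ biprod.fst - v ≫ y) (by
        rw [Preadditive.sub_comp, hu2, hv]; simp [hw1])
      refine ⟨v + k ≫ φ, ?_⟩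
      change (v + k ≫ φ) ≫ i = u
      have h12 := ex12 D'
      ext
      · simp only [i, Category.assoc, biprod.lift_fst, Preadditive.add_comp, hy, ← hk]
        abel
      · simp [i, hv, h12]) (radHom K hA (Y ⊞ W))
  have r1 : LinearMap.range (Linear.rightComp K A g1) = LinearMap.range (Linear.rightComp K A p) := by
    ext u
    constructor
    · rintro ⟨v, rfl⟩
      exact ⟨v ≫ n, by simp [hn]⟩
    · rintro ⟨v, rfl⟩
      exact ⟨v ≫ m, by simp [hm]⟩
  have r2 : (radHom K hA Y1).map (Linear.rightComp K A g1) =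
      (radHom K hA (Y ⊞ W)).map (Linear.rightComp K A p) := by
    ext u
    constructor
    · rintro ⟨v, hv, rfl⟩
      exact ⟨v ≫ n, radHom_comp K hA _ _ hv, by simp [hn]⟩
    · rintro ⟨v, hv, rfl⟩
      exact ⟨v ≫ m, radHom_comp K hA _ _ hv, by simp [hm]⟩
  have r3 : (radHom K hA Y1).comap (Linear.rightComp K A x1) =
      (radHom K hA (Y ⊞ W)).comap (Linear.rightComp K A i) := by
    ext v
    simp only [Submodule.mem_comap, mem_radHom]
    rw [not_iff_not]
    change (∃ r, (v ≫ x1) ≫ r = 𝟙 A) ↔ ∃ r, (v ≫ i) ≫ r = 𝟙 A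
    constructor
    · rintro ⟨c, hc⟩
      obtain ⟨a1, ha1⟩ := ex1 D (φ ≫ x1 ≫ c) (by
        have h1 := ex1' D1
        rw [Category.assoc] at h1
        simp [reassoc_of% h1])
      obtain ⟨a2, ha2⟩ := yo2 D' (x1 ≫ c - y ≫ a1) (by
        rw [Preadditive.comp_sub, reassoc_of% hy, ha1]; simp)
      refine ⟨biprod.desc a1 a2, ?_⟩
      rw [Category.assoc, ← hc, Category.assoc]
      congr 1
      simp [i, ← ha2]
    · rintro ⟨c, hc⟩
      obtain ⟨c', hc'⟩ := ex1 D1 (i ≫ c) (by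
        have h12 := ex12 D'
        have : φ ≫ i ≫ c = f ≫ biprod.inl ≫ c := by
          have : φ ≫ i = f ≫ biprod.inl := by
            ext <;> simp [i, hy, h12]
          rw [reassoc_of% this]
        have h1 := ex1' D
        rw [Category.assoc, ← Functor.map_comp, this, Functor.map_comp, reassoc_of% h1]
        simp)
      exact ⟨c', by rw [Category.assoc, hc', ← hc, Category.assoc]⟩
  unfold muMult
  rw [c1, c2, r1, r2, r3]

end TriLemmas

section Main

open Module

variable {C : Type u} [Category.{v} C] [Preadditive C] [HasZeroObject C] [HasShift C ℤ]
  [∀ n : ℤ, (shiftFunctor C n).Additive] [Pretriangulated C] [HasFiniteBiproducts C]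

lemma IsARTriangle.h_ne {X Y Z : C} {f : X ⟶ Y} {g : Y ⟶ Z} {h : Z ⟶ X⟦(1 : ℤ)⟧}
    (H : IsARTriangle C f g h) : h ≠ 0 := by
  intro h0
  obtain ⟨s, hs⟩ := co3 H.distinguished (𝟙 Z) (by simp [h0])
  exact H.not_retraction ⟨s, hs.symm⟩

/-- `h` of an AR triangle factors through every nonzero map to `X[1]`. -/
lemma IsARTriangle.factor {X Y Z : C} {f : X ⟶ Y} {g : Y ⟶ Z} {h : Z ⟶ X⟦(1 : ℤ)⟧}
    (H : IsARTriangle C f g h) {W : C} (v : W ⟶ X⟦(1 : ℤ)⟧) (hv : v ≠ 0) :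
    ∃ w : Z ⟶ W, h = w ≫ v := by
  obtain ⟨E, a, b, D⟩ := distinguished_cocone_triangle₂ v
  obtain ⟨y, hy⟩ := H.left_almost_split a (by
    rintro ⟨r, hr⟩
    apply hv
    have h1 := ex1' D
    calc v = v ≫ (𝟙 X)⟦(1 : ℤ)⟧' := by simp
      _ = (v ≫ a⟦(1 : ℤ)⟧') ≫ r⟦(1 : ℤ)⟧' := by rw [← hr]; simp
      _ = 0 := by rw [h1]; simp)
  obtain ⟨w, -, hw⟩ := tri_map D H.distinguished y hy
  exact ⟨w, hw⟩

lemma arOff_subset (T : Set C) (hT : IsClusterTilting C T) :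
    arRelTriOff C T ⊆ relTriRel C T := by
  rintro x ⟨X, Y, Z, f, g, h, H, hX, rfl⟩
  refine ⟨Triangle.mk f g h, H.distinguished, ?_, rfl⟩
  have h1 : X⟦(-1 : ℤ)⟧ ∉ T := fun h2 => hX ⟨_, h2, ⟨(shiftNegShift X (1 : ℤ)).symm⟩⟩
  rw [hT.char_left] at h1
  push Not at h1
  obtain ⟨t, ht, φ, hφ⟩ := h1
  let v : t⟦(1 : ℤ)⟧ ⟶ X⟦(1 : ℤ)⟧ := (φ ≫ (shiftNegShift X (1 : ℤ)).hom)⟦(1 : ℤ)⟧'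
  have hv : v ≠ 0 := by
    intro h0
    apply hφ
    have : φ ≫ (shiftNegShift X (1 : ℤ)).hom = 0 := by
      apply (shiftFunctor C (1 : ℤ)).map_injective
      rw [Functor.map_zero]; exact h0
    rw [← cancel_mono (shiftNegShift X (1 : ℤ)).hom, this, zero_comp]
  obtain ⟨w, hw⟩ := H.factor v hv
  exact ⟨t, ht, w, v, hw.symm⟩

variable (K : Type w) [Field K] [Linear K C]

lemma main_ind (hKS : IsKrullSchmidt C) (homFin : ∀ X Y : C, FiniteDimensional K (X ⟶ Y))
    (hAR : HasARTriangles C) (T : Set C) {Z Z0 : C} (e : Z ≅ Z0⟦(1 : ℤ)⟧) (L : C)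
    (hL : ∀ A : C, LocEnd A → (∃ φ : Z0 ⟶ A, φ ≠ 0) → ∃ (s : A ⟶ L) (r : L ⟶ A), s ≫ r = 𝟙 A)
    (N : ℕ) : ∀ (M : ℕ) (X Y : C) (k : Z0 ⟶ X) (f : X ⟶ Y) (g : Y ⟶ Z),
      Triangle.mk f g (e.hom ≫ k⟦(1 : ℤ)⟧') ∈ distTriang C →
      (∀ A ∈ shiftSet C T, ∀ p : X ⟶ A, k ≫ p = 0) →
      finrank K (LinearMap.range (Linear.leftComp K L k)) < N → finrank K (X ⟶ X) < M →
      clsZero C X + clsZero C Z - clsZero C Y ∈ AddSubgroup.closure (arRelTriOff C T) := by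
  have := homFin
  induction N with
  | zero => intro M X Y k f g D hk hN; omega
  | succ N ihN =>
  intro M
  induction M with
  | zero => intro X Y k f g D hk hN hM; omega
  | succ M ihM =>
  intro X Y k f g D hk hN hM
  by_cases hs : ∃ (A : C) (_ : LocEnd A) (s : A ⟶ X) (π : X ⟶ A), s ≫ π = 𝟙 A ∧ k ≫ π = 0
  · -- split off a summand
    obtain ⟨A, hA, s, π, hsπ, hkπ⟩ := hs
    obtain ⟨X', ι, ρ, eX, D', hιρ⟩ := split_epi' s π hsπ
    obtain ⟨k', hk'⟩ := co2 D' k hkπ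
    obtain ⟨Y', f', g', D2⟩ := distinguished_cocone_triangle₂ (e.hom ≫ k'⟦(1 : ℤ)⟧')
    have hY := push_lemma K hKS homFin D2 D' (ρ ≫ f') (by rw [reassoc_of% hιρ])
      (x1 := f) (g1 := g) (by
        rw [Category.assoc, ← Functor.map_comp, ← hk']; exact D)
    have hk'2 : k' = k ≫ ρ := by rw [hk', Category.assoc, hιρ, Category.comp_id]
    have key := ihM X' Y' k' f' g' D2 (by
      intro A hA p
      rw [hk'2, Category.assoc]
      exact hk A hA _) (by
      refine lt_of_le_of_lt (Submodule.finrank_mono ?_) hN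
      rintro _ ⟨q, rfl⟩
      exact ⟨ρ ≫ q, by simp [hk'2]⟩) (by
      have hlt : finrank K (X' ⟶ X') < finrank K (X ⟶ X) := by
        let F : (X' ⟶ X') →ₗ[K] (X ⟶ X) := (Linear.leftComp K X ρ).comp (Linear.rightComp K X' ι)
        have hF : ∀ u, F u = ρ ≫ u ≫ ι := fun u => rfl
        have hinj : Function.Injective F := by
          intro u v huv
          rw [hF, hF] at huv
          calc u = (ι ≫ (ρ ≫ u ≫ ι)) ≫ ρ := by simp [reassoc_of% hιρ, hιρ]
            _ = v := by rw [huv]; simp [reassoc_of% hιρ, hιρ]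
        rw [← LinearMap.finrank_range_of_inj hinj]
        apply Submodule.finrank_lt
        intro htop
        have h1 : 𝟙 X ∈ LinearMap.range F := by rw [htop]; trivial
        obtain ⟨u, hu⟩ := h1
        rw [hF] at hu
        apply hA.1
        have h12 := ex12 D'
        calc 𝟙 A = s ≫ 𝟙 X ≫ π := by simp [hsπ]
          _ = 0 := by rw [← hu]; simp [h12]
      omega)
    have : clsZero C X + clsZero C Z - clsZero C Y =
        clsZero C X' + clsZero C Z - clsZero C Y' := by
      rw [hY, cls_iso eX, cls_biprod]; abel
    rw [this]; exact key
  · by_cases hk0 : k = 0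
    · subst hk0
      have D0 : Triangle.mk f g (0 : Z ⟶ X⟦(1 : ℤ)⟧) ∈ distTriang C := by
        have : e.hom ≫ (0 : Z0 ⟶ X)⟦(1 : ℤ)⟧' = 0 := by simp
        rw [this] at D; exact D
      obtain ⟨eY, -⟩ := tri_split D0
      rw [cls_iso eY, cls_biprod, sub_self]
      exact AddSubgroup.zero_mem _
    · -- push out along an AR triangle
      obtain ⟨n, F, eX, hF⟩ := exists_comp hKS X
      have : ∃ j, k ≫ eX.hom ≫ biproduct.π F j ≠ 0 := by
        by_contra hcon
        push Not at hcon
        apply hk0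
        rw [← cancel_mono eX.hom, zero_comp]
        apply biproduct.hom_ext
        intro j
        rw [Category.assoc, hcon, zero_comp]
      obtain ⟨j, hj⟩ := this
      generalize hπ : eX.hom ≫ biproduct.π F j = π at hj
      obtain ⟨s, hsπ⟩ : ∃ s, s ≫ π = 𝟙 (F j) := ⟨biproduct.ι F j ≫ eX.inv, by simp [← hπ]⟩
      have hA := hF j
      clear hπ
      generalize F j = A at π hj s hsπ hA
      obtain ⟨E, W, a, b, c, H⟩ := hAR A hA.indec
      obtain ⟨X', π', e', DX, -⟩ := split_mono' s π hsπ
      obtain ⟨X1, φ, β, D'⟩ := distinguished_cocone_triangle₂ (c ≫ s⟦(1 : ℤ)⟧')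
      have hX1 : clsZero C X1 = clsZero C E + clsZero C X' :=
        push_lemma K hKS homFin H.distinguished DX (π ≫ a) (by rw [reassoc_of% hsπ]) D'
      obtain ⟨v, hv⟩ := H.left_almost_split (s ≫ f) (by
        rintro ⟨r, hr⟩
        apply hs
        refine ⟨A, hA, s, f ≫ r, by simpa using hr, ?_⟩
        have h1 := ex1' D
        apply (shiftFunctor C (1 : ℤ)).map_injective
        rw [Category.assoc] at h1
        rw [← cancel_epi e.hom]
        simp [reassoc_of% h1])
      obtain ⟨y, hy⟩ := ex1 D' f (by
        have h1 := ex1' H.distinguished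
        rw [Category.assoc, ← Functor.map_comp, ← hv, Functor.map_comp, reassoc_of% h1]
        simp)
      obtain ⟨Y1, x1, g1, D1⟩ := distinguished_cocone_triangle₂ (e.hom ≫ (k ≫ φ)⟦(1 : ℤ)⟧')
      have hY1 : clsZero C Y1 = clsZero C Y + clsZero C W :=
        push_lemma K hKS homFin D D' y hy (x1 := x1) (g1 := g1) (by
          rw [Category.assoc, ← Functor.map_comp]; exact D1)
      have key := ihN (finrank K (X1 ⟶ X1) + 1) X1 Y1 (k ≫ φ) x1 g1 D1 (by
        intro B hB p
        rw [Category.assoc]; exact hk B hB _) (by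
        refine lt_of_lt_of_le ?_ (Nat.lt_succ_iff.1 hN)
        apply Submodule.finrank_lt_finrank_of_lt
        rw [SetLike.lt_iff_le_and_exists]
        constructor
        · rintro _ ⟨q, rfl⟩
          exact ⟨φ ≫ q, by simp⟩
        · obtain ⟨i, r, hir⟩ := hL A hA ⟨k ≫ π, hj⟩
          refine ⟨k ≫ π ≫ i, ⟨π ≫ i, rfl⟩, ?_⟩
          rintro ⟨q, hq⟩
          have hq' : (k ≫ φ) ≫ q = k ≫ π ≫ i := hq
          -- `s ≫ φ` is not a section
          have hns : ¬ IsIso ((s ≫ φ) ≫ q ≫ r) := by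
            intro hiso
            apply H.h_ne
            have h1 := ex1' D'
            rw [Category.assoc, ← Functor.map_comp] at h1
            have h2 : c ≫ ((s ≫ φ) ≫ q ≫ r)⟦(1 : ℤ)⟧' = 0 := by
              rw [Functor.map_comp, reassoc_of% h1, zero_comp]
            rw [← cancel_mono (((s ≫ φ) ≫ q ≫ r)⟦(1 : ℤ)⟧'), h2, zero_comp]
          have hiso := (hA.2 ((s ≫ φ) ≫ q ≫ r) (𝟙 A - (s ≫ φ) ≫ q ≫ r) (by abel)).resolve_left hns
          apply hs
          refine ⟨A, hA, inv (𝟙 A - (s ≫ φ) ≫ q ≫ r) ≫ s, π - φ ≫ q ≫ r, ?_, ?_⟩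
          · have : s ≫ (π - φ ≫ q ≫ r) = 𝟙 A - (s ≫ φ) ≫ q ≫ r := by
              rw [Preadditive.comp_sub, hsπ]; simp
            rw [Category.assoc, this, IsIso.inv_hom_id]
          · rw [Preadditive.comp_sub]
            have : k ≫ φ ≫ q ≫ r = k ≫ π := by
              have := congrArg (· ≫ r) hq'
              simpa [hir] using this
            rw [this, sub_self]) (Nat.lt_succ_self _)
      have hl : clsZero C A + clsZero C W - clsZero C E ∈
          AddSubgroup.closure (arRelTriOff C T) := by
        apply AddSubgroup.subset_closure
        exact ⟨A, E, W, a, b, c, H, fun hAT => hj (hk A hAT π), rfl⟩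
      have : clsZero C X + clsZero C Z - clsZero C Y =
          (clsZero C X1 + clsZero C Z - clsZero C Y1) +
          (clsZero C A + clsZero C W - clsZero C E) := by
        rw [hX1, hY1, cls_iso e', cls_biprod]; abel
      rw [this]
      exact AddSubgroup.add_mem _ key hl

lemma exists_L (hKS : IsKrullSchmidt C) (hLF : LocFinite C) (Z0 : C) :
    ∃ L : C, ∀ A : C, LocEnd A → (∃ φ : Z0 ⟶ A, φ ≠ 0) →
      ∃ (s : A ⟶ L) (r : L ⟶ A), s ≫ r = 𝟙 A := by
  obtain ⟨n, F, eZ, hF⟩ := exists_comp hKS Z0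
  choose m ind hind using fun i => (hLF (F i) (hF i).indec).1
  refine ⟨⨁ fun i => ⨁ ind i, ?_⟩
  rintro A hA ⟨φ, hφ⟩
  have : ∃ j, biproduct.ι F j ≫ eZ.inv ≫ φ ≠ 0 := by
    by_contra hcon
    push Not at hcon
    apply hφ
    rw [← cancel_epi eZ.inv, comp_zero]
    apply biproduct.hom_ext'
    intro j
    rw [hcon, comp_zero]
  obtain ⟨j, hj⟩ := this
  obtain ⟨l, ⟨e⟩⟩ := hind j A hA.indec ⟨_, hj⟩
  exact ⟨e.hom ≫ biproduct.ι (ind j) l ≫ biproduct.ι (fun i => ⨁ ind i) j,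
    biproduct.π (fun i => ⨁ ind i) j ≫ biproduct.π (ind j) l ≫ e.inv, by simp⟩

lemma rel_le (hKS : IsKrullSchmidt C) (homFin : ∀ X Y : C, FiniteDimensional K (X ⟶ Y))
    (hAR : HasARTriangles C) (T : Set C) (hT : IsClusterTilting C T) (hLF : LocFinite C) :
    relTriRel C T ⊆ AddSubgroup.closure (arRelTriOff C T) := by
  rintro x ⟨⟨X, Y, Z, f, g, h⟩, D, ⟨t, ht, u, v, huv⟩, rfl⟩
  dsimp at u v huv ⊢
  let e : Z ≅ (Z⟦(-1 : ℤ)⟧)⟦(1 : ℤ)⟧ := (shiftNegShift Z (1 : ℤ)).symm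
  obtain ⟨k, hk⟩ := (shiftFunctor C (1 : ℤ)).map_surjective (e.inv ≫ h)
  have hk' : e.hom ≫ k⟦(1 : ℤ)⟧' = h := by rw [hk]; simp
  obtain ⟨L, hL⟩ := exists_L hKS hLF (Z⟦(-1 : ℤ)⟧)
  refine main_ind K hKS homFin hAR T e L hL _ _ X Y k f g (by rw [hk']; exact D) ?_
    (Nat.lt_succ_self _) (Nat.lt_succ_self _)
  rintro A ⟨t', ht', ⟨i⟩⟩ p
  obtain ⟨v0, rfl⟩ := (shiftFunctor C (1 : ℤ)).map_surjective v
  have h0 : v0 ≫ p = 0 := by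
    have := (hT.char_left t').1 ht' t ht (v0 ≫ p ≫ i.hom)
    rw [← cancel_mono i.hom, zero_comp, Category.assoc, this]
  apply (shiftFunctor C (1 : ℤ)).map_injective
  rw [Functor.map_comp, hk, ← huv, Category.assoc, Category.assoc, ← Functor.map_comp, h0]
  simp

end Main

section Converse

open Module

variable {C : Type u} [Category.{v} C] [Preadditive C] [HasZeroObject C] [HasShift C ℤ]
  [∀ n : ℤ, (shiftFunctor C n).Additive] [Pretriangulated C] [HasFiniteBiproducts C]

lemma LocEnd.shift {B : C} (hB : LocEnd B) (n : ℤ) : LocEnd (B⟦n⟧) := by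
  refine ⟨fun h0 => hB.1 ?_, fun a b hab => ?_⟩
  · apply (shiftFunctor C n).map_injective
    rw [Functor.map_zero, CategoryTheory.Functor.map_id]; exact h0
  · obtain ⟨a', rfl⟩ := (shiftFunctor C n).map_surjective a
    obtain ⟨b', rfl⟩ := (shiftFunctor C n).map_surjective b
    rw [← Functor.map_add, ← CategoryTheory.Functor.map_id] at hab
    have h1 := (shiftFunctor C n).map_injective hab
    rcases hB.2 a' b' h1 with h2 | h2
    · left; infer_instance
    · right; infer_instance

variable (K : Type w) [Field K] [Linear K C]

lemma finrank_exact {U V W : Type*} [AddCommGroup U] [AddCommGroup V] [AddCommGroup W]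
    [Module K U] [Module K V] [Module K W] [FiniteDimensional K V]
    (p : U →ₗ[K] V) (q : V →ₗ[K] W) (hp : Function.Injective p) (hq : Function.Surjective q)
    (hpq : ∀ x, q x = 0 ↔ ∃ y, p y = x) : finrank K V = finrank K U + finrank K W := by
  have h1 : LinearMap.range p = LinearMap.ker q := by
    ext x
    rw [LinearMap.mem_ker, hpq]; rfl
  have h2 := q.finrank_range_add_finrank_ker
  rw [← h1, LinearMap.finrank_range_of_inj hp, LinearMap.range_eq_top.2 hq, finrank_top] at h2
  omega

/-- `dim Hom(-, B)` on `K0Zero`. -/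
def phiB (homFin : ∀ X Y : C, FiniteDimensional K (X ⟶ Y)) (B : C) : K0Zero C →+ ℤ :=
  k0lift (fun X => (finrank K (X ⟶ B) : ℤ))
    (fun X Y => by
      have := homFin
      rw [(biprodHomEquiv K X Y B).finrank_eq, finrank_prod]; push_cast; rfl)
    (fun X Y e => by
      rw [(Linear.homCongr K e (Iso.refl B)).finrank_eq])

/-- `dim Hom(B, -)` on `K0Zero`. -/
def psiB (homFin : ∀ X Y : C, FiniteDimensional K (X ⟶ Y)) (B : C) : K0Zero C →+ ℤ :=
  k0lift (fun X => (finrank K (B ⟶ X) : ℤ))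
    (fun X Y => by
      have := homFin
      rw [(homBiprodEquiv K B X Y).finrank_eq, finrank_prod]; push_cast; rfl)
    (fun X Y e => by
      rw [(Linear.homCongr K (Iso.refl B) e).finrank_eq])

lemma phiB_cls (homFin : ∀ X Y : C, FiniteDimensional K (X ⟶ Y)) (B A : C) :
    phiB K homFin B (clsZero C A) = finrank K (A ⟶ B) := k0lift_cls _ _ _ A

lemma psiB_cls (homFin : ∀ X Y : C, FiniteDimensional K (X ⟶ Y)) (B A : C) :
    psiB K homFin B (clsZero C A) = finrank K (B ⟶ A) := k0lift_cls _ _ _ A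

lemma phi_ar (hKS : IsKrullSchmidt C) (homFin : ∀ X Y : C, FiniteDimensional K (X ⟶ Y))
    {X Y Z : C} {f : X ⟶ Y} {g : Y ⟶ Z} {h : Z ⟶ X⟦(1 : ℤ)⟧}
    (H : IsARTriangle C f g h) (B : C) (hB : LocEnd B) (h1 : ¬ Nonempty (B ≅ X))
    (h2 : ¬ Nonempty (B ≅ X⟦(1 : ℤ)⟧)) :
    phiB K homFin B (clsZero C X + clsZero C Z - clsZero C Y) = 0 := by
  have := homFin
  have hX : LocEnd X := H.indec₁.locEnd hKS
  have D := H.distinguished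
  have key := finrank_exact K (Linear.leftComp K B g) (Linear.leftComp K B f) (by
      rw [injective_iff_map_eq_zero]
      intro u hu
      obtain ⟨u', rfl⟩ := yo3 D u hu
      obtain ⟨w, hw⟩ := (shiftFunctor C (1 : ℤ)).map_surjective
        (u' ≫ (shiftNegShift B (1 : ℤ)).inv)
      obtain ⟨w', hw'⟩ := H.left_almost_split w (by
        rintro ⟨r, hr⟩
        obtain ⟨e⟩ := hX.iso_of_section (hB.shift (-1)) w r hr
        exact h2 ⟨(shiftNegShift B (1 : ℤ)).symm ≪≫ ((shiftFunctor C (1 : ℤ)).mapIso e).symm⟩)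
      have h3 : u' = w⟦(1 : ℤ)⟧' ≫ (shiftNegShift B (1 : ℤ)).hom :=
        ((Iso.eq_comp_inv _).1 hw).symm
      have h4 : h ≫ w⟦(1 : ℤ)⟧' = 0 := by
        rw [← hw', Functor.map_comp, ← Category.assoc, ex1' D, zero_comp]
      rw [h3]
      exact (Category.assoc _ _ _).symm.trans ((congrArg (· ≫ _) h4).trans zero_comp))
    (by
      intro u
      obtain ⟨v, hv⟩ := H.left_almost_split u (by
        rintro ⟨r, hr⟩
        obtain ⟨e⟩ := hX.iso_of_section hB u r hr
        exact h1 ⟨e.symm⟩)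
      exact ⟨v, hv⟩)
    (by
      intro x
      constructor
      · intro hx
        obtain ⟨r, hr⟩ := yo2 D x hx
        exact ⟨r, hr.symm⟩
      · rintro ⟨r, rfl⟩
        change f ≫ g ≫ r = 0
        rw [← Category.assoc, ex12 D, zero_comp])
  rw [map_sub, map_add, phiB_cls, phiB_cls, phiB_cls, key]
  push_cast; ring

lemma psi_ar (hKS : IsKrullSchmidt C) (homFin : ∀ X Y : C, FiniteDimensional K (X ⟶ Y))
    {X Y Z : C} {f : X ⟶ Y} {g : Y ⟶ Z} {h : Z ⟶ X⟦(1 : ℤ)⟧}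
    (H : IsARTriangle C f g h) (B : C) (hB : LocEnd B) (h1 : ¬ Nonempty (B ≅ Z))
    (h2 : ¬ Nonempty (B ≅ Z⟦(-1 : ℤ)⟧)) :
    psiB K homFin B (clsZero C X + clsZero C Z - clsZero C Y) = 0 := by
  have := homFin
  have hZ : LocEnd Z := H.indec₃.locEnd hKS
  have D := H.distinguished
  have key := finrank_exact K (Linear.rightComp K B f) (Linear.rightComp K B g) (by
      rw [injective_iff_map_eq_zero]
      intro u hu
      have hu' : u ≫ f = 0 := hu
      obtain ⟨v, hv⟩ := co1 D (u⟦(1 : ℤ)⟧') (by rw [← Functor.map_comp, hu', Functor.map_zero])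
      obtain ⟨w', hw'⟩ := H.right_almost_split v (by
        rintro ⟨s, hs⟩
        obtain ⟨e⟩ := hZ.iso_of_section (hB.shift 1) s v hs
        exact h2 ⟨(shiftShiftNeg B (1 : ℤ)).symm ≪≫ ((shiftFunctor C (-1 : ℤ)).mapIso e).symm⟩)
      apply (shiftFunctor C (1 : ℤ)).map_injective
      rw [hv, ← hw', Category.assoc, ex23 D, comp_zero, Functor.map_zero])
    (by
      intro u
      obtain ⟨v, hv⟩ := H.right_almost_split u (by
        rintro ⟨s, hs⟩
        obtain ⟨e⟩ := hZ.iso_of_section hB s u hs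
        exact h1 ⟨e.symm⟩)
      exact ⟨v, hv⟩)
    (by
      intro x
      constructor
      · intro hx
        obtain ⟨r, hr⟩ := co2 D x hx
        exact ⟨r, hr.symm⟩
      · rintro ⟨r, rfl⟩
        change (r ≫ f) ≫ g = 0
        rw [Category.assoc, ex12 D, comp_zero])
  rw [map_sub, map_add, psiB_cls, psiB_cls, psiB_cls, key]
  push_cast; ring

lemma closure_fin (S : Set (K0Zero C)) (P : C → Prop) (φ : C → (K0Zero C →+ ℤ))
    (hS : ∀ x ∈ S, ∃ l : List C, ∀ B, P B → φ B x ≠ 0 → ∃ D ∈ l, Nonempty (B ≅ D))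
    (x : K0Zero C) (hx : x ∈ AddSubgroup.closure S) :
    ∃ l : List C, ∀ B, P B → φ B x ≠ 0 → ∃ D ∈ l, Nonempty (B ≅ D) := by
  induction hx using AddSubgroup.closure_induction with
  | mem x hx => exact hS x hx
  | zero => exact ⟨[], fun B _ h => absurd (map_zero _) h⟩
  | add x y _ _ hx hy =>
    obtain ⟨l1, h1⟩ := hx
    obtain ⟨l2, h2⟩ := hy
    refine ⟨l1 ++ l2, fun B hB h => ?_⟩
    by_cases hx0 : φ B x = 0
    · have : φ B y ≠ 0 := fun h0 => h (by rw [map_add, hx0, h0, add_zero])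
      obtain ⟨D, hD, e⟩ := h2 B hB this
      exact ⟨D, List.mem_append_right _ hD, e⟩
    · obtain ⟨D, hD, e⟩ := h1 B hB hx0
      exact ⟨D, List.mem_append_left _ hD, e⟩
  | neg x _ hx =>
    obtain ⟨l, h1⟩ := hx
    exact ⟨l, fun B hB h => h1 B hB (by simpa using h)⟩

lemma finrank_hom_pos (homFin : ∀ X Y : C, FiniteDimensional K (X ⟶ Y)) {A B : C}
    (φ : A ⟶ B) (h : φ ≠ 0) : 0 < finrank K (A ⟶ B) := by
  have := homFin A B
  have : Nontrivial (A ⟶ B) := ⟨φ, 0, h⟩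
  exact finrank_pos

lemma T_fin (hKS : IsKrullSchmidt C) (homFin : ∀ X Y : C, FiniteDimensional K (X ⟶ Y))
    (T : Set C) (hgen : relTriRel C T ⊆ AddSubgroup.closure (arRelTriOff C T))
    (t : C) (ht : t ∈ T) :
    ∃ l : List C, ∀ B, LocEnd B → ((∃ φ : t ⟶ B, φ ≠ 0) ∨ (∃ φ : t⟦(1 : ℤ)⟧ ⟶ B, φ ≠ 0) ∨
      (∃ φ : B ⟶ t, φ ≠ 0) ∨ (∃ φ : B ⟶ t⟦(1 : ℤ)⟧, φ ≠ 0)) → ∃ D ∈ l, Nonempty (B ≅ D) := by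
  have hmem : clsZero C t + clsZero C (t⟦(1 : ℤ)⟧) - clsZero C (0 : C) ∈
      AddSubgroup.closure (arRelTriOff C T) :=
    hgen ⟨_, contractible_distinguished₂ t, ⟨t, ht, 𝟙 _, 𝟙 _, Category.comp_id _⟩, rfl⟩
  rw [cls_zero (isZero_zero C), sub_zero] at hmem
  obtain ⟨l1, h1⟩ := closure_fin _ LocEnd (phiB K homFin) (by
    rintro x ⟨X, Y, Z, f, g, h, H, -, rfl⟩
    refine ⟨[X, X⟦(1 : ℤ)⟧], fun B hB hne => ?_⟩
    by_contra hcon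
    apply hne
    apply phi_ar K hKS homFin H B hB
    · exact fun e => hcon ⟨X, by simp, e⟩
    · exact fun e => hcon ⟨X⟦(1 : ℤ)⟧, by simp, e⟩) _ hmem
  obtain ⟨l2, h2⟩ := closure_fin _ LocEnd (psiB K homFin) (by
    rintro x ⟨X, Y, Z, f, g, h, H, -, rfl⟩
    refine ⟨[Z, Z⟦(-1 : ℤ)⟧], fun B hB hne => ?_⟩
    by_contra hcon
    apply hne
    apply psi_ar K hKS homFin H B hB
    · exact fun e => hcon ⟨Z, by simp, e⟩
    · exact fun e => hcon ⟨Z⟦(-1 : ℤ)⟧, by simp, e⟩) _ hmem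
  refine ⟨l1 ++ l2, fun B hB hor => ?_⟩
  have h1' := h1 B hB
  have h2' := h2 B hB
  rw [map_add, phiB_cls, phiB_cls] at h1'
  rw [map_add, psiB_cls, psiB_cls] at h2'
  have a1 : ((finrank K (t ⟶ B) : ℤ) + finrank K (t⟦(1 : ℤ)⟧ ⟶ B) ≠ 0) ∨
      ((finrank K (B ⟶ t) : ℤ) + finrank K (B ⟶ t⟦(1 : ℤ)⟧) ≠ 0) := by
    rcases hor with ⟨φ, hφ⟩ | ⟨φ, hφ⟩ | ⟨φ, hφ⟩ | ⟨φ, hφ⟩ <;>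
      have := finrank_hom_pos K homFin φ hφ <;> omega
  rcases a1 with a | a
  · obtain ⟨D, hD, e⟩ := h1' a
    exact ⟨D, List.mem_append_left _ hD, e⟩
  · obtain ⟨D, hD, e⟩ := h2' a
    exact ⟨D, List.mem_append_right _ hD, e⟩

lemma locFinite_of_gen (hKS : IsKrullSchmidt C)
    (homFin : ∀ X Y : C, FiniteDimensional K (X ⟶ Y))
    (T : Set C) (hT : IsClusterTilting C T)
    (hgen : relTriRel C T ⊆ AddSubgroup.closure (arRelTriOff C T)) : LocFinite C := by
  intro A _
  obtain ⟨T0, hT0, p, hp⟩ := hT.contravariantly_finite A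
  obtain ⟨T1, i, d, D⟩ := distinguished_cocone_triangle₁ p
  have hT1 : T1 ∈ T := by
    rw [hT.char_left]
    intro t ht φ
    obtain ⟨ψ, rfl⟩ := co1 D φ ((hT.char_left T0).1 hT0 t ht _)
    obtain ⟨q, rfl⟩ := hp t ht ψ
    rw [Category.assoc, ex23 D, comp_zero]
  obtain ⟨l0, h0⟩ := T_fin K hKS homFin T hgen T0 hT0
  obtain ⟨l1, h1⟩ := T_fin K hKS homFin T hgen T1 hT1
  have main : ∀ B, LocEnd B → ((∃ φ : A ⟶ B, φ ≠ 0) ∨ (∃ φ : B ⟶ A, φ ≠ 0)) →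
      ∃ E ∈ l0 ++ l1, Nonempty (B ≅ E) := by
    intro B hB hor
    have a : (∃ E ∈ l0, Nonempty (B ≅ E)) ∨ (∃ E ∈ l1, Nonempty (B ≅ E)) := by
      rcases hor with ⟨φ, hφ⟩ | ⟨φ, hφ⟩
      · by_cases hz : p ≫ φ = 0
        · obtain ⟨r, rfl⟩ := yo3 D φ hz
          refine Or.inr (h1 B hB (Or.inr (Or.inl ⟨r, ?_⟩)))
          rintro rfl
          exact hφ comp_zero
        · exact Or.inl (h0 B hB (Or.inl ⟨_, hz⟩))
      · by_cases hz : φ ≫ d = 0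
        · obtain ⟨r, rfl⟩ := co3 D φ hz
          refine Or.inl (h0 B hB (Or.inr (Or.inr (Or.inl ⟨r, ?_⟩))))
          rintro rfl
          exact hφ zero_comp
        · exact Or.inr (h1 B hB (Or.inr (Or.inr (Or.inr ⟨_, hz⟩))))
    rcases a with ⟨E, hE, e⟩ | ⟨E, hE, e⟩
    · exact ⟨E, List.mem_append_left _ hE, e⟩
    · exact ⟨E, List.mem_append_right _ hE, e⟩
  constructor
  · refine ⟨(l0 ++ l1).length, (l0 ++ l1).get, fun B hB hφ => ?_⟩
    obtain ⟨E, hE, e⟩ := main B (hB.locEnd hKS) (Or.inl hφ)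
    obtain ⟨j, rfl⟩ := List.mem_iff_get.1 hE
    exact ⟨j, e⟩
  · refine ⟨(l0 ++ l1).length, (l0 ++ l1).get, fun B hB hφ => ?_⟩
    obtain ⟨E, hE, e⟩ := main B (hB.locEnd hKS) (Or.inr hφ)
    obtain ⟨j, rfl⟩ := List.mem_iff_get.1 hE
    exact ⟨j, e⟩

end Converse

theorem stmt9 (C : Type u) [Category.{v} C] [Preadditive C] [HasZeroObject C] [HasShift C ℤ]
    [∀ n : ℤ, (shiftFunctor C n).Additive] [Pretriangulated C] [HasFiniteBiproducts C]
    (hKS : IsKrullSchmidt C) (K : Type w) [Field K] [Linear K C]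
    (homFin : ∀ X Y : C, FiniteDimensional K (X ⟶ Y))
    (hAR : HasARTriangles C) (T : Set C) (hT : IsClusterTilting C T) :
    (gProj C T).ker = AddSubgroup.closure (arRelTriOff C T) ↔ LocFinite C := by
  have hker : (gProj C T).ker = AddSubgroup.closure (relTriRel C T) :=
    QuotientAddGroup.ker_mk' _
  rw [hker]
  constructor
  · intro h
    apply locFinite_of_gen K hKS homFin T hT
    rw [← h]
    exact AddSubgroup.subset_closure
  · intro hLF
    exact le_antisymm ((AddSubgroup.closure_le _).2 (rel_le K hKS homFin hAR T hT hLF))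
      (AddSubgroup.closure_mono (arOff_subset T hT))
end
end
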